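/- Let Ω ⊂ ℝⁿ be an open set with 0 ∈ ∂Ω, and suppose there is ρ > 0 with B_ρ(−ρe₁) ⊂ ℝⁿ \ Ω̄. Let f be bounded measurable and let u be a nonnegative Lipschitz function on B₁ ∩ Ω̄ satisfying 𝓛u = f weakly in B₁ ∩ Ω and u = 0 on ∂Ω ∩ B₁. Then there exists α ≥ 0 such that u(x) = αx₁ + o(|x|) as x → 0 with x ∈ Ω̄ ∩ B₁, i.e. (u(x) − αx₁)/|x| → 0 as x → 0 in Ω̄ ∩ B₁. In particular, if α > 0 then x₁ = o(|x|) as x → 0 along ∂Ω ∩ B₁, that is, ∂Ω is tangent at 0 to the hyperplane {x₁ = 0}. -/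

import Mathlib

open Set Filter MeasureTheory Metric Bornology
open scoped Topology RealInnerProductSpace ENNReal NNReal

noncomputable section

/-- Euclidean space `ℝⁿ`. -/
abbrev EucSp (n : ℕ) := EuclideanSpace ℝ (Fin n)

variable {n : ℕ}

/-- Uniform ellipticity of the coefficient field `A` on the set `s`:
`λ|ξ|² ≤ ⟨A(x)ξ, ξ⟩ ≤ Λ|ξ|²`. -/
def IsElliptic (A : EucSp n → (EucSp n →L[ℝ] EucSp n)) (lam Lam : ℝ)
    (s : Set (EucSp n)) : Prop :=
  ∀ x ∈ s, ∀ ξ : EucSp n,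
    lam * ‖ξ‖ ^ 2 ≤ ⟪A x ξ, ξ⟫ ∧ ⟪A x ξ, ξ⟫ ≤ Lam * ‖ξ‖ ^ 2

/-- Symmetry of the coefficient field on `s`. -/
def IsSymmCoeff (A : EucSp n → (EucSp n →L[ℝ] EucSp n)) (s : Set (EucSp n)) : Prop :=
  ∀ x ∈ s, ∀ ξ η : EucSp n, ⟪A x ξ, η⟫ = ⟪ξ, A x η⟫

/-- `A` is Hölder continuous with exponent `γ` and seminorm at most `K` on `s`. -/
def HolderSemi (A : EucSp n → (EucSp n →L[ℝ] EucSp n)) (γ K : ℝ)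
    (s : Set (EucSp n)) : Prop :=
  ∀ x ∈ s, ∀ y ∈ s, ‖A x - A y‖ ≤ K * ‖x - y‖ ^ γ

/-- `v` is locally Lipschitz on the set `s`. -/
def LocLipOn (v : EucSp n → ℝ) (s : Set (EucSp n)) : Prop :=
  ∀ x ∈ s, ∃ K : ℝ≥0, ∃ t ∈ 𝓝[s] x, LipschitzOnWith K v t

/-- A test function for the weak formulation in the open set `D`:
smooth with compact support contained in `D`. -/
def IsTest (D : Set (EucSp n)) (φ : EucSp n → ℝ) : Prop :=
  ContDiff ℝ (⊤ : ℕ∞) φ ∧ HasCompactSupport φ ∧ tsupport φ ⊆ D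

/-- `𝓛 v = div(A ∇ v) = f` weakly in `D`:
`∫_D ⟨A(x)∇v, ∇φ⟩ = −∫_D f φ` for every test function `φ`. -/
def WeakEq (A : EucSp n → (EucSp n →L[ℝ] EucSp n)) (v f : EucSp n → ℝ)
    (D : Set (EucSp n)) : Prop :=
  ∀ φ : EucSp n → ℝ, IsTest D φ →
    ∫ x in D, ⟪A x (gradient v x), gradient φ x⟫ = - ∫ x in D, f x * φ x

/-- `𝓛 v ≥ f` weakly in `D`:
`∫_D ⟨A(x)∇v, ∇φ⟩ ≤ −∫_D f φ` for every nonnegative test function `φ`. -/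
def WeakGe (A : EucSp n → (EucSp n →L[ℝ] EucSp n)) (v f : EucSp n → ℝ)
    (D : Set (EucSp n)) : Prop :=
  ∀ φ : EucSp n → ℝ, IsTest D φ → (∀ x, 0 ≤ φ x) →
    ∫ x in D, ⟪A x (gradient v x), gradient φ x⟫ ≤ - ∫ x in D, f x * φ x

/-- `𝓛 v ≤ f` weakly in `D`:
`∫_D ⟨A(x)∇v, ∇φ⟩ ≥ −∫_D f φ` for every nonnegative test function `φ`. -/
def WeakLe (A : EucSp n → (EucSp n →L[ℝ] EucSp n)) (v f : EucSp n → ℝ)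
    (D : Set (EucSp n)) : Prop :=
  ∀ φ : EucSp n → ℝ, IsTest D φ → (∀ x, 0 ≤ φ x) →
    - ∫ x in D, f x * φ x ≤ ∫ x in D, ⟪A x (gradient v x), gradient φ x⟫

/-- The positive part `v⁺ = max(v, 0)`. -/
def PPart (v : EucSp n → ℝ) : EucSp n → ℝ := fun x => max (v x) 0

/-- The negative part `v⁻ = max(−v, 0)`. -/
def NPart (v : EucSp n → ℝ) : EucSp n → ℝ := fun x => max (-v x) 0

/-- The right-hand side `f·χ_{v<0}`. -/
def ChiNeg (f v : EucSp n → ℝ) : EucSp n → ℝ := fun x => if v x < 0 then f x else 0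

/-- `Ω⁺(v) = {x ∈ Ω : v(x) > 0}`. -/
def plusSet (Ω : Set (EucSp n)) (v : EucSp n → ℝ) : Set (EucSp n) :=
  {x ∈ Ω | 0 < v x}

/-- `Ω⁻(v)` = interior of `{x ∈ Ω : v(x) ≤ 0}`. -/
def minusSet (Ω : Set (EucSp n)) (v : EucSp n → ℝ) : Set (EucSp n) :=
  interior {x ∈ Ω | v x ≤ 0}

/-- The free boundary `F(v) = ∂{v > 0} ∩ Ω`. -/
def freeBdry (Ω : Set (EucSp n)) (v : EucSp n → ℝ) : Set (EucSp n) :=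
  frontier (plusSet Ω v) ∩ Ω

/-- `x₀ ∈ F(v)` is regular from the right, via the touching ball `B(y,r) ⊆ Ω⁺(v)`
with `B̄ ∩ F(v) = {x₀}`. -/
def TouchRight (Ω : Set (EucSp n)) (v : EucSp n → ℝ) (x₀ y : EucSp n) (r : ℝ) : Prop :=
  0 < r ∧ ball y r ⊆ plusSet Ω v ∧ closure (ball y r) ∩ freeBdry Ω v = {x₀}

/-- `x₀ ∈ F(v)` is regular from the left, via the touching ball `B(y,r) ⊆ Ω⁻(v)`
with `B̄ ∩ F(v) = {x₀}`. -/
def TouchLeft (Ω : Set (EucSp n)) (v : EucSp n → ℝ) (x₀ y : EucSp n) (r : ℝ) : Prop :=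
  0 < r ∧ ball y r ⊆ minusSet Ω v ∧ closure (ball y r) ∩ freeBdry Ω v = {x₀}

/-- The unit normal at `x₀` to a ball centered at `y` touching `F(v)` from the
right at `x₀`, pointing towards `Ω⁺(v)`, i.e. into the ball. -/
def nuRight (x₀ y : EucSp n) : EucSp n := ‖y - x₀‖⁻¹ • (y - x₀)

/-- The unit normal at `x₀` to a ball centered at `y` touching `F(v)` from the
left at `x₀`, pointing towards `Ω⁺(v)`, i.e. away from the ball. -/
def nuLeft (x₀ y : EucSp n) : EucSp n := ‖x₀ - y‖⁻¹ • (x₀ - y)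

/-- `v(x) ≤ α⟨x − x₀, ν⟩⁺ + o(|x − x₀|)` as `x → x₀` within `s`. -/
def ExpandLe (v : EucSp n → ℝ) (x₀ ν : EucSp n) (α : ℝ) (s : Set (EucSp n)) : Prop :=
  ∀ ε > (0:ℝ), ∀ᶠ x in 𝓝[s] x₀,
    v x ≤ α * max ⟪x - x₀, ν⟫ 0 + ε * ‖x - x₀‖

/-- `v(x) ≥ α⟨x − x₀, ν⟩⁺ + o(|x − x₀|)` as `x → x₀` within `s`. -/
def ExpandGe (v : EucSp n → ℝ) (x₀ ν : EucSp n) (α : ℝ) (s : Set (EucSp n)) : Prop :=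
  ∀ ε > (0:ℝ), ∀ᶠ x in 𝓝[s] x₀,
    α * max ⟪x - x₀, ν⟫ 0 - ε * ‖x - x₀‖ ≤ v x

/-- `v(x) = o(|x − x₀|)` as `x → x₀` within `s`. -/
def SmallO (v : EucSp n → ℝ) (x₀ : EucSp n) (s : Set (EucSp n)) : Prop :=
  ∀ ε > (0:ℝ), ∀ᶠ x in 𝓝[s] x₀, |v x| ≤ ε * ‖x - x₀‖

/-- The non-tangential cone at `x₀` in direction `ν` with opening parameter `θ`. -/
def ntCone (x₀ ν : EucSp n) (θ : ℝ) : Set (EucSp n) :=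
  {x | θ * ‖x - x₀‖ < ⟪x - x₀, ν⟫}

/-- Hypotheses on the free boundary condition function `G(β, x, ν)`: strictly
increasing in `β ≥ 0`, Lipschitz in all arguments, and
`G(0) := inf_{x ∈ Ω, |ν|=1} G(0, x, ν) ≥ G0 > 0`. -/
def GHyp (Ω : Set (EucSp n)) (G : ℝ → EucSp n → EucSp n → ℝ) (G0 : ℝ) : Prop :=
  (∀ x ν, StrictMonoOn (fun β => G β x ν) (Ici (0:ℝ))) ∧
  (∃ LG : ℝ≥0, LipschitzWith LG (fun p : ℝ × EucSp n × EucSp n => G p.1 p.2.1 p.2.2)) ∧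
  0 < G0 ∧ ∀ x ∈ Ω, ∀ ν : EucSp n, ‖ν‖ = 1 → G0 ≤ G 0 x ν

/-- A (crude) notion of bounded Lipschitz domain: bounded, open, and near every
boundary point, `Ω` is the supergraph of a Lipschitz function in some direction. -/
def IsLipschitzDomain (Ω : Set (EucSp n)) : Prop :=
  IsOpen Ω ∧ IsBounded Ω ∧ Ω.Nonempty ∧
  ∀ x ∈ frontier Ω, ∃ r : ℝ, 0 < r ∧ ∃ (g : EucSp n → ℝ) (L : ℝ≥0) (e : EucSp n),
    ‖e‖ = 1 ∧ LipschitzWith L g ∧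
    ∀ y ∈ ball x r, (y ∈ Ω ↔ g (y - ⟪y, e⟫ • e) < ⟪y, e⟫)

/-- The class `𝓕` of admissible supersolutions (Definition 1.2). -/
def memF (A : EucSp n → (EucSp n →L[ℝ] EucSp n)) (Ω : Set (EucSp n))
    (f₁ f₂ : EucSp n → ℝ) (G : ℝ → EucSp n → EucSp n → ℝ) (w : EucSp n → ℝ) : Prop :=
  ContinuousOn w (closure Ω) ∧ LocLipOn w (closure Ω) ∧
  WeakLe A w f₁ (plusSet Ω w) ∧
  WeakLe A w (ChiNeg f₂ w) (minusSet Ω w) ∧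
  (∀ x₀ y r, TouchLeft Ω w x₀ y r →
    ∃ α β : ℝ, 0 ≤ α ∧ 0 ≤ β ∧
      ExpandLe (PPart w) x₀ (nuLeft x₀ y) α Set.univ ∧
      ExpandGe (NPart w) x₀ (-(nuLeft x₀ y)) β Set.univ ∧
      α < G β x₀ (nuLeft x₀ y)) ∧
  (∀ x₀ ∈ freeBdry Ω w, (∀ y r, ¬ TouchLeft Ω w x₀ y r) → SmallO w x₀ Set.univ)

/-- A minorant (strict subsolution) for the free boundary problem. -/
def IsMinorant (A : EucSp n → (EucSp n →L[ℝ] EucSp n)) (Ω : Set (EucSp n))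
    (f₁ f₂ : EucSp n → ℝ) (G : ℝ → EucSp n → EucSp n → ℝ) (u : EucSp n → ℝ) : Prop :=
  LocLipOn u Ω ∧
  WeakGe A u f₁ (plusSet Ω u) ∧
  WeakGe A u (ChiNeg f₂ u) (minusSet Ω u) ∧
  ∀ x₀ ∈ freeBdry Ω u, ∃ y r, TouchRight Ω u x₀ y r ∧
    ∃ α β : ℝ, 0 ≤ α ∧ 0 ≤ β ∧
      ExpandGe (PPart u) x₀ (nuRight x₀ y) α Set.univ ∧
      ExpandLe (NPart u) x₀ (-(nuRight x₀ y)) β Set.univ ∧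
      G β x₀ (nuRight x₀ y) < α

/-- A weak solution of the two-phase free boundary problem (Definition 1.1). -/
def IsWeakSolution (A : EucSp n → (EucSp n →L[ℝ] EucSp n)) (Ω : Set (EucSp n))
    (f₁ f₂ : EucSp n → ℝ) (G : ℝ → EucSp n → EucSp n → ℝ) (u : EucSp n → ℝ) : Prop :=
  ContinuousOn u Ω ∧
  WeakEq A u f₁ (plusSet Ω u) ∧
  WeakEq A u (ChiNeg f₂ u) (minusSet Ω u) ∧
  (∀ x₀ y r, TouchRight Ω u x₀ y r →
    ∃ α β : ℝ, 0 ≤ α ∧ 0 ≤ β ∧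
      ExpandGe (PPart u) x₀ (nuRight x₀ y) α (ball y r) ∧
      ExpandLe (NPart u) x₀ (-(nuRight x₀ y)) β (closure (ball y r))ᶜ ∧
      (∀ θ ∈ Ioo (0:ℝ) 1,
        SmallO (fun x => PPart u x - α * ⟪x - x₀, nuRight x₀ y⟫) x₀
          (ntCone x₀ (nuRight x₀ y) θ) ∧
        SmallO (fun x => NPart u x - β * ⟪x - x₀, -(nuRight x₀ y)⟫) x₀
          (ntCone x₀ (-(nuRight x₀ y)) θ)) ∧
      α ≤ G β x₀ (nuRight x₀ y)) ∧
  (∀ x₀ y r, TouchLeft Ω u x₀ y r →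
    ∃ α β : ℝ, 0 ≤ α ∧ 0 ≤ β ∧
      ExpandGe (NPart u) x₀ (-(nuLeft x₀ y)) β (ball y r) ∧
      ExpandLe (PPart u) x₀ (nuLeft x₀ y) α (closure (ball y r))ᶜ ∧
      (∀ θ ∈ Ioo (0:ℝ) 1,
        SmallO (fun x => PPart u x - α * ⟪x - x₀, nuLeft x₀ y⟫) x₀
          (ntCone x₀ (nuLeft x₀ y) θ) ∧
        SmallO (fun x => NPart u x - β * ⟪x - x₀, -(nuLeft x₀ y)⟫) x₀
          (ntCone x₀ (-(nuLeft x₀ y)) θ)) ∧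
      G β x₀ (nuLeft x₀ y) ≤ α)

/-- The Perron family: admissible supersolutions above the minorant `ubar`
with boundary values `φb`. -/
def PerronFam (A : EucSp n → (EucSp n →L[ℝ] EucSp n)) (Ω : Set (EucSp n))
    (f₁ f₂ : EucSp n → ℝ) (G : ℝ → EucSp n → EucSp n → ℝ)
    (ubar φb : EucSp n → ℝ) : Set (EucSp n → ℝ) :=
  {w | memF A Ω f₁ f₂ G w ∧ (∀ x ∈ closure Ω, ubar x ≤ w x) ∧
       ∀ x ∈ frontier Ω, w x = φb x}

section WeakDivergence

variable {E : Type*} [NormedAddCommGroup E] [InnerProductSpace ℝ E]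

lemma ContDiff.exists_lipschitzWith_of_hasCompactSupport {θ : E → ℝ} (h : ContDiff ℝ 1 θ)
    (hc : HasCompactSupport θ) : ∃ C : ℝ≥0, LipschitzWith C θ :=
  h.lipschitzWith_of_hasCompactSupport hc one_ne_zero

variable [FiniteDimensional ℝ E]

lemma norm_gradient_le_of_lipschitzWith {w : E → ℝ} {C : ℝ≥0} (hw : LipschitzWith C w) (x : E) :
    ‖gradient w x‖ ≤ C := by
  rw [gradient, LinearIsometryEquiv.norm_map]
  exact norm_fderiv_le_of_lipschitz ℝ hw

variable [MeasurableSpace E] {μ : Measure E}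

/-- `ℓ` is the divergence of the vector field `X`, tested against Lipschitz functions. -/
def IsWeakDiv (μ : Measure E) (X : E → E) (ℓ : E → ℝ) : Prop :=
  ∀ (w : E → ℝ) (C : ℝ≥0), LipschitzWith C w →
    ∫ y, ⟪gradient w y, X y⟫ ∂μ = - ∫ y, w y * ℓ y ∂μ

lemma IsWeakDiv.neg {X : E → E} {ℓ : E → ℝ} (h : IsWeakDiv μ X ℓ) :
    IsWeakDiv μ (fun y => -X y) (fun y => -ℓ y) := by
  intro w C hw
  simp only [inner_neg_right, mul_neg, integral_neg, h w C hw]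

variable [BorelSpace E]

lemma stronglyMeasurable_gradient (w : E → ℝ) : StronglyMeasurable (gradient w) :=
  (InnerProductSpace.toDual ℝ E).symm.continuous.comp_stronglyMeasurable
    (measurable_fderiv ℝ w).stronglyMeasurable

lemma integrable_inner_gradient {w : E → ℝ} {C : ℝ≥0} (hw : LipschitzWith C w) {X : E → E}
    (hX : Integrable X μ) : Integrable (fun y => ⟪gradient w y, X y⟫) μ := by
  refine (hX.norm.const_mul (C : ℝ)).mono'
    ((stronglyMeasurable_gradient w).aestronglyMeasurable.inner hX.1) (ae_of_all _ fun y => ?_)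
  exact (norm_inner_le_norm _ _).trans
    (mul_le_mul_of_nonneg_right (norm_gradient_le_of_lipschitzWith hw y) (norm_nonneg _))

lemma IsWeakDiv.add [IsFiniteMeasureOnCompacts μ] {X Y : E → E} {ℓ m : E → ℝ}
    (hX : IsWeakDiv μ X ℓ) (hY : IsWeakDiv μ Y m)
    (iX : Integrable X μ) (iY : Integrable Y μ) (cl : Continuous ℓ) (cm : Continuous m)
    (sl : HasCompactSupport ℓ) (sm : HasCompactSupport m) :
    IsWeakDiv μ (fun y => X y + Y y) (fun y => ℓ y + m y) := by
  intro w C hw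
  simp only [inner_add_right, mul_add]
  have i1 : Integrable (fun y => w y * ℓ y) μ :=
    (hw.continuous.mul cl).integrable_of_hasCompactSupport sl.mul_left
  have i2 : Integrable (fun y => w y * m y) μ :=
    (hw.continuous.mul cm).integrable_of_hasCompactSupport sm.mul_left
  rw [integral_add (integrable_inner_gradient hw iX) (integrable_inner_gradient hw iY),
    integral_add i1 i2, hX w C hw, hY w C hw]
  ring

variable [μ.IsAddHaarMeasure]

lemma isWeakDiv_smul_const {θ : E → ℝ} (h : ContDiff ℝ 1 θ) (hc : HasCompactSupport θ) (c : E) :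
    IsWeakDiv μ (fun y => θ y • c) (fun y => ⟪gradient θ y, c⟫) := by
  intro w C hw
  obtain ⟨D, hD⟩ := h.exists_lipschitzWith_of_hasCompactSupport hc
  have key := hw.integral_lineDeriv_mul_eq (μ := μ) hD hc c
  have h1 : ∫ y, lineDeriv ℝ w y c * θ y ∂μ = ∫ y, ⟪gradient w y, θ y • c⟫ ∂μ := by
    refine integral_congr_ae ?_
    filter_upwards [hw.ae_differentiableAt (μ := μ)] with y hy
    rw [hy.lineDeriv_eq_fderiv, inner_smul_right, inner_gradient_left, mul_comm]
  rw [← h1, key, ← integral_neg]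
  refine integral_congr_ae (ae_of_all _ fun y => ?_)
  have hy : DifferentiableAt ℝ θ y := h.differentiable one_ne_zero y
  simp only [hy.lineDeriv_eq_fderiv, inner_gradient_left, map_neg]
  ring

lemma isWeakDiv_smul_sub {θ : E → ℝ} (h : ContDiff ℝ 1 θ) (hc : HasCompactSupport θ) (x : E) :
    IsWeakDiv μ (fun y => θ y • (y - x))
      (fun y => Module.finrank ℝ E * θ y + ⟪gradient θ y, y - x⟫) := by
  intro w C hw
  let b := stdOrthonormalBasis ℝ E
  let s : Fin (Module.finrank ℝ E) → E → ℝ := fun i y => θ y * ⟪b i, y - x⟫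
  have hs : ∀ i, ContDiff ℝ 1 (s i) := fun i =>
    h.mul (contDiff_const.inner ℝ (contDiff_id.sub contDiff_const))
  have hsc : ∀ i, HasCompactSupport (s i) := fun i => hc.mul_right
  have hgrad : ∀ i y, ⟪gradient (s i) y, b i⟫
      = θ y + ⟪b i, y - x⟫ * ⟪gradient θ y, b i⟫ := by
    intro i y
    have hy : HasFDerivAt θ (fderiv ℝ θ y) y := (h.differentiable one_ne_zero y).hasFDerivAt
    have h2 : HasFDerivAt (fun z => ⟪b i, z - x⟫) (innerSL ℝ (b i)) y := by
      have := (innerSL ℝ (b i)).hasFDerivAt (x := y - x)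
      exact this.comp y ((hasFDerivAt_id y).sub_const x)
    have h3 := (hy.mul h2).fderiv
    rw [inner_gradient_left, inner_gradient_left]
    have h4 : fderiv ℝ (s i) y = _ := h3
    rw [h4]
    simp
  have hX : ∀ y, ⟪gradient w y, θ y • (y - x)⟫ = ∑ i, ⟪gradient w y, s i y • b i⟫ := by
    intro y
    rw [← inner_sum]
    congr 1
    conv_lhs => rw [← b.sum_repr' (y - x), Finset.smul_sum]
    simp [s, smul_smul]
  have hL : ∀ y, ∑ i, w y * ⟪gradient (s i) y, b i⟫
      = w y * (Module.finrank ℝ E * θ y + ⟪gradient θ y, y - x⟫) := by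
    intro y
    rw [← Finset.mul_sum]
    congr 1
    simp only [hgrad, Finset.sum_add_distrib]
    congr 1
    · simp
    · conv_rhs => rw [← b.sum_repr' (y - x), inner_sum]
      simp [inner_smul_right]
  simp only [hX]
  rw [integral_finsetSum]
  · simp_rw [fun i => isWeakDiv_smul_const (μ := μ) (hs i) (hsc i) (b i) w C hw]
    rw [Finset.sum_neg_distrib, ← integral_finsetSum]
    · simp only [hL]
    · intro i _
      have hcs : HasCompactSupport (fun y => ⟪gradient (s i) y, b i⟫) := by
        simp only [inner_gradient_left]
        exact (hsc i).fderiv_apply ℝ (b i)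
      have hct : Continuous (fun y => ⟪gradient (s i) y, b i⟫) := by
        simp only [inner_gradient_left]
        exact ((hs i).continuous_fderiv one_ne_zero).clm_apply continuous_const
      exact (hw.continuous.mul hct).integrable_of_hasCompactSupport hcs.mul_left
  · intro i _
    exact integrable_inner_gradient hw
      (((hs i).continuous.smul continuous_const).integrable_of_hasCompactSupport
        (hsc i).smul_right)

end WeakDivergence

section CutPow

/-- The truncated power `(1 - s)₊ ^ k`. -/
def cutPow (k : ℕ) (s : ℝ) : ℝ := max (1 - s) 0 ^ k

lemma cutPow_nonneg (k : ℕ) (s : ℝ) : 0 ≤ cutPow k s := pow_nonneg (le_max_right _ _) k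

lemma cutPow_le_one (k : ℕ) {s : ℝ} (hs : 0 ≤ s) : cutPow k s ≤ 1 :=
  pow_le_one₀ (le_max_right _ _) (max_le (by linarith) zero_le_one)

lemma cutPow_eq_zero {k : ℕ} (hk : k ≠ 0) {s : ℝ} (hs : 1 ≤ s) : cutPow k s = 0 := by
  rw [cutPow, max_eq_right (by linarith), zero_pow hk]

lemma cutPow_anti (k : ℕ) : Antitone (cutPow k) := fun _ _ h =>
  pow_le_pow_left₀ (le_max_right _ _) (max_le_max (by linarith) le_rfl) k

lemma cutPow_pos (k : ℕ) {s : ℝ} (hs : s < 1) : 0 < cutPow k s :=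
  pow_pos (lt_max_of_lt_left (by linarith)) k

@[fun_prop]
lemma continuous_cutPow (k : ℕ) : Continuous (cutPow k) :=
  ((continuous_const.sub continuous_id).max continuous_const).pow k

lemma mul_cutPow_le_one {k : ℕ} (hk : k ≠ 0) {s : ℝ} (hs : 0 ≤ s) : s * cutPow k s ≤ 1 := by
  rcases le_total s 1 with h | h
  · exact mul_le_one₀ h (cutPow_nonneg k s) (cutPow_le_one k hs)
  · rw [cutPow_eq_zero hk h]; simp

lemma cutPow_succ (k : ℕ) (s : ℝ) : cutPow (k + 2) s = (1 - s) * cutPow (k + 1) s := by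
  rcases le_total s 1 with h | h
  · rw [cutPow, cutPow, max_eq_left (by linarith)]; ring
  · rw [cutPow_eq_zero (by simp) h, cutPow_eq_zero (by simp) h, mul_zero]

lemma hasDerivAt_cutPow (k : ℕ) (s : ℝ) :
    HasDerivAt (cutPow (k + 2)) (-(k + 2 : ℝ) * cutPow (k + 1) s) s := by
  rcases lt_trichotomy s 1 with h | rfl | h
  · have h1 : HasDerivAt (fun s : ℝ => (1 - s) ^ (k + 2)) (-(k + 2 : ℝ) * cutPow (k + 1) s) s := by
      have h2 : HasDerivAt (fun s : ℝ => 1 - s) (-1) s := by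
        simpa using (hasDerivAt_id s).const_sub 1
      have h3 : cutPow (k + 1) s = (1 - s) ^ (k + 1) := by rw [cutPow, max_eq_left (by linarith)]
      refine (h2.fun_pow (k + 2)).congr_deriv ?_
      rw [h3]
      push_cast
      ring
    refine h1.congr_of_eventuallyEq ?_
    filter_upwards [Iio_mem_nhds h] with t ht
    rw [cutPow, max_eq_left (by simp at ht; linarith)]
  · rw [cutPow_eq_zero (by simp) le_rfl, mul_zero, hasDerivAt_iff_tendsto_slope]
    have h2 : Tendsto (fun t => - cutPow (k + 1) t) (𝓝[≠] 1) (𝓝 0) := by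
      have := ((continuous_cutPow (k + 1)).neg.tendsto 1)
      simp only [Pi.neg_apply, cutPow_eq_zero (k := k + 1) (by simp) le_rfl, neg_zero] at this
      exact this.mono_left nhdsWithin_le_nhds
    refine h2.congr' ?_
    filter_upwards [self_mem_nhdsWithin] with t ht
    have : t - 1 ≠ 0 := sub_ne_zero.2 ht
    rw [slope_def_field, cutPow_succ, cutPow_eq_zero (by simp) le_rfl]
    field_simp
    ring
  · rw [cutPow_eq_zero (by simp) h.le, mul_zero]
    refine (hasDerivAt_const s (0 : ℝ)).congr_of_eventuallyEq ?_
    filter_upwards [Ioi_mem_nhds h] with t ht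
    exact cutPow_eq_zero (by simp) (le_of_lt ht)

lemma contDiff_cutPow (k : ℕ) : ContDiff ℝ 1 (cutPow (k + 2)) := by
  rw [contDiff_one_iff_deriv]
  refine ⟨fun s => (hasDerivAt_cutPow k s).differentiableAt, ?_⟩
  have : deriv (cutPow (k + 2)) = fun s => -(k + 2 : ℝ) * cutPow (k + 1) s :=
    funext fun s => (hasDerivAt_cutPow k s).deriv
  rw [this]
  fun_prop

lemma abs_cutPow_two_sub_le (s t : ℝ) (hs : 0 ≤ s) (ht : 0 ≤ t) :
    |cutPow 2 s - cutPow 2 t| ≤ 2 * |s - t| := by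
  have h1 : |max (1 - s) 0 - max (1 - t) 0| ≤ |s - t| := by
    refine (abs_max_sub_max_le_abs _ _ _).trans ?_
    rw [abs_sub_comm s t]; apply le_of_eq; congr 1; ring
  have h2 : |max (1 - s) 0 + max (1 - t) 0| ≤ 2 := by
    rw [abs_of_nonneg (add_nonneg (le_max_right _ _) (le_max_right _ _))]
    have : max (1 - s) 0 ≤ 1 := max_le (by linarith) zero_le_one
    have : max (1 - t) 0 ≤ 1 := max_le (by linarith) zero_le_one
    linarith
  rw [cutPow, cutPow, sq_sub_sq, abs_mul]
  exact mul_le_mul h2 h1 (abs_nonneg _) zero_le_two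

lemma cutPow_three_sub_le (s t : ℝ) :
    cutPow 3 s - cutPow 3 t ≤ 3 * cutPow 2 s * (t - s) := by
  simp only [cutPow]
  rcases le_total s 1 with h | h <;> rcases le_total t 1 with h' | h'
  · rw [max_eq_left (by linarith), max_eq_left (by linarith)]
    nlinarith [mul_nonneg (sq_nonneg (s - t)) (by linarith : 0 ≤ 2 * (1 - s) + (1 - t))]
  · rw [max_eq_left (by linarith), max_eq_right (by linarith)]
    nlinarith [mul_nonneg (sq_nonneg (1 - s)) (by linarith : 0 ≤ 1 - s),
      mul_nonneg (sq_nonneg (1 - s)) (by linarith : 0 ≤ t - 1)]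
  · rw [max_eq_right (by linarith), max_eq_left (by linarith)]
    have := pow_nonneg (by linarith : 0 ≤ 1 - t) 3
    simp; linarith
  · rw [max_eq_right (by linarith), max_eq_right (by linarith)]; simp

end CutPow

/-- A symmetric invertible constant coefficient matrix `A`, with positive definite inverse `B`. -/
structure FrozenCoeff (E : Type*) [NormedAddCommGroup E] [InnerProductSpace ℝ E] where
  A : E →L[ℝ] E
  B : E →L[ℝ] E
  A_B : ∀ y, A (B y) = y
  B_A : ∀ y, B (A y) = y
  symm_A : ∀ x y, ⟪A x, y⟫ = ⟪x, A y⟫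
  symm_B : ∀ x y, ⟪B x, y⟫ = ⟪x, B y⟫
  b : ℝ
  b_pos : 0 < b
  le_B : ∀ y, b * ‖y‖ ^ 2 ≤ ⟪B y, y⟫

namespace FrozenCoeff

variable {E : Type*} [NormedAddCommGroup E] [InnerProductSpace ℝ E] (P : FrozenCoeff E)

/-- The quadratic form of the inverse matrix. -/
def q (y : E) : ℝ := ⟪P.B y, y⟫

/-- The truncated power of the quadratic form rescaled by `σ` and centred at `x`. -/
def bump (k : ℕ) (σ : ℝ) (x y : E) : ℝ := cutPow k (σ ^ 2 * P.q (y - x))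

lemma b_mul_le_q (y : E) : P.b * ‖y‖ ^ 2 ≤ P.q y := P.le_B y

lemma q_nonneg (y : E) : 0 ≤ P.q y :=
  (mul_nonneg P.b_pos.le (sq_nonneg _)).trans (P.le_B y)

@[fun_prop]
lemma continuous_q : Continuous P.q := by unfold q; fun_prop

lemma q_smul (r : ℝ) (y : E) : P.q (r • y) = r ^ 2 * P.q y := by
  simp only [q, map_smul, inner_smul_left, inner_smul_right, conj_trivial]; ring

lemma q_add (x y : E) : P.q (x + y) = P.q x + 2 * ⟪P.B x, y⟫ + P.q y := by
  simp only [q, map_add, inner_add_left, inner_add_right]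
  rw [P.symm_B y x, real_inner_comm (P.B x) y]; ring

lemma q_neg (y : E) : P.q (-y) = P.q y := by simp [q]

@[fun_prop]
lemma continuous_bump (k : ℕ) (σ : ℝ) (x : E) : Continuous (P.bump k σ x) := by
  unfold bump; fun_prop

lemma bump_nonneg (k : ℕ) (σ : ℝ) (x y : E) : 0 ≤ P.bump k σ x y := cutPow_nonneg _ _

lemma sq_mul_q_nonneg (σ : ℝ) (y : E) : 0 ≤ σ ^ 2 * P.q y := mul_nonneg (sq_nonneg _) (P.q_nonneg _)

lemma bump_le_one (k : ℕ) (σ : ℝ) (x y : E) : P.bump k σ x y ≤ 1 :=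
  cutPow_le_one _ (P.sq_mul_q_nonneg _ _)

lemma norm_sub_lt_of_bump_ne_zero {k : ℕ} (hk : k ≠ 0) {σ : ℝ} (hσ : 0 < σ) {x y : E}
    (h : P.bump k σ x y ≠ 0) : ‖y - x‖ < σ⁻¹ * (√P.b)⁻¹ := by
  have hb : 0 < √P.b := Real.sqrt_pos.2 P.b_pos
  by_contra! hc
  refine h (cutPow_eq_zero hk ?_)
  have h1 : 1 ≤ σ * √P.b * ‖y - x‖ := by
    have := mul_le_mul_of_nonneg_left hc (mul_pos hσ hb).le
    refine le_trans (le_of_eq ?_) this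
    field_simp
  have h2 : (1 : ℝ) ≤ (σ * √P.b * ‖y - x‖) ^ 2 := one_le_pow₀ h1
  rw [mul_pow, mul_pow, Real.sq_sqrt P.b_pos.le, mul_assoc] at h2
  exact h2.trans (mul_le_mul_of_nonneg_left (P.b_mul_le_q _) (sq_nonneg _))

lemma support_bump_subset {k : ℕ} (hk : k ≠ 0) {σ : ℝ} (hσ : 0 < σ) (x : E) :
    Function.support (P.bump k σ x) ⊆ closedBall 0 (σ⁻¹ * (√P.b)⁻¹ + ‖x‖) := by
  intro y hy
  have := P.norm_sub_lt_of_bump_ne_zero hk hσ hy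
  rw [mem_closedBall_zero_iff]
  calc ‖y‖ = ‖(y - x) + x‖ := by simp
    _ ≤ ‖y - x‖ + ‖x‖ := norm_add_le _ _
    _ ≤ _ := by gcongr

lemma contDiff_q : ContDiff ℝ 1 P.q := by
  unfold q
  exact P.B.contDiff.inner ℝ contDiff_id

lemma contDiff_bump (k : ℕ) (σ : ℝ) (x : E) : ContDiff ℝ 1 (P.bump (k + 2) σ x) :=
  (contDiff_cutPow k).comp
    (contDiff_const.mul (P.contDiff_q.comp (contDiff_id.sub contDiff_const)))

lemma hasFDerivAt_q (y : E) : HasFDerivAt P.q ((2 : ℝ) • innerSL ℝ (P.B y)) y := by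
  have h := P.B.hasFDerivAt (x := y)
  have := h.inner ℝ (hasFDerivAt_id y)
  refine this.congr_fderiv ?_
  ext z
  simp only [ContinuousLinearMap.comp_apply, ContinuousLinearMap.prod_apply, fderivInnerCLM_apply,
    _root_.smul_apply, innerSL_apply_apply, id_eq, smul_eq_mul,
    ContinuousLinearMap.id_apply, P.symm_B z y, real_inner_comm]
  ring

lemma hasFDerivAt_bump (k : ℕ) (σ : ℝ) (x y : E) :
    HasFDerivAt (P.bump (k + 2) σ x)
      ((-2 * (k + 2) * σ ^ 2 * P.bump (k + 1) σ x y) • innerSL ℝ (P.B (y - x))) y := by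
  have h1 : HasFDerivAt (fun y => P.q (y - x)) ((2 : ℝ) • innerSL ℝ (P.B (y - x))) y :=
    (HasFDerivAt.comp (g := P.q) y (P.hasFDerivAt_q (y - x))
      ((hasFDerivAt_id y).sub_const x)).congr_fderiv (ContinuousLinearMap.comp_id _)
  have := (hasDerivAt_cutPow k (σ ^ 2 * P.q (y - x))).comp_hasFDerivAt y (h1.const_mul (σ ^ 2))
  refine this.congr_fderiv ?_
  ext z
  simp only [bump, _root_.smul_apply, smul_eq_mul, innerSL_apply_apply]
  ring

lemma hasFDerivAt_inner_left (e y : E) : HasFDerivAt (fun y => ⟪e, y⟫) (innerSL ℝ e) y :=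
  (innerSL ℝ e).hasFDerivAt

variable [FiniteDimensional ℝ E]

lemma hasCompactSupport_bump {k : ℕ} (hk : k ≠ 0) {σ : ℝ} (hσ : 0 < σ) (x : E) :
    HasCompactSupport (P.bump k σ x) :=
  HasCompactSupport.of_support_subset_isCompact (isCompact_closedBall _ _)
    (P.support_bump_subset hk hσ x)

lemma gradient_bump (k : ℕ) (σ : ℝ) (x y : E) : gradient (P.bump (k + 2) σ x) y =
    (-2 * (k + 2) * σ ^ 2 * P.bump (k + 1) σ x y) • P.B (y - x) := by
  refine ext_inner_right ℝ fun z => ?_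
  rw [inner_gradient_left, (P.hasFDerivAt_bump k σ x y).fderiv, inner_smul_left]
  rfl

/-- Divergence of `A ∇` of a truncated power of the quadratic form. -/
def divBump (d σ : ℝ) (x y : E) : ℝ :=
  -8 * σ ^ 2 * (d * P.bump 3 σ x y - 6 * (σ ^ 2 * P.q (y - x)) * P.bump 2 σ x y)

/-- Divergence of `A ∇` of the linear function `⟪e, ·⟫` times a truncated power. -/
def divLin (d : ℝ) (e y : E) : ℝ :=
  -6 * ⟪e, y⟫ * ((d + 2) * P.bump 2 1 0 y - 4 * P.q y * P.bump 1 1 0 y)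

lemma gradient_inner_mul_bump (k : ℕ) (e y : E) :
    gradient (fun y => ⟪e, y⟫ * P.bump (k + 2) 1 0 y) y =
      P.bump (k + 2) 1 0 y • e + (-2 * (k + 2) * ⟪e, y⟫ * P.bump (k + 1) 1 0 y) • P.B y := by
  refine ext_inner_right ℝ fun z => ?_
  rw [inner_gradient_left, ((hasFDerivAt_inner_left e y).fun_mul (P.hasFDerivAt_bump k 1 0 y)).fderiv]
  simp only [inner_add_left, inner_smul_left, _root_.add_apply,
    _root_.smul_apply, smul_eq_mul, innerSL_apply_apply, sub_zero, conj_trivial]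
  ring

variable [MeasurableSpace E] [BorelSpace E] {μ : Measure E} [μ.IsAddHaarMeasure]

lemma isWeakDiv_bump {σ : ℝ} (hσ : 0 < σ) (x : E) :
    IsWeakDiv μ (fun y => P.A (gradient (P.bump 4 σ x) y))
      (P.divBump (Module.finrank ℝ E) σ x) := by
  have h := isWeakDiv_smul_sub (μ := μ) (θ := fun y => -8 * σ ^ 2 * P.bump 3 σ x y)
    (contDiff_const.mul (P.contDiff_bump 1 σ x))
    (P.hasCompactSupport_bump (by simp) hσ x).mul_left x
  convert h using 1
  · funext y
    rw [P.gradient_bump 2 σ x y, map_smul, P.A_B]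
    norm_num
  · funext y
    have h1 := (P.hasFDerivAt_bump 1 σ x y).const_mul (-8 * σ ^ 2)
    rw [inner_gradient_left, h1.fderiv]
    simp only [divBump, _root_.smul_apply, smul_eq_mul, innerSL_apply_apply, q]
    push_cast
    ring

lemma isWeakDiv_lin (e : E) :
    IsWeakDiv μ (fun y => P.A (gradient (fun y => ⟪e, y⟫ * P.bump 3 1 0 y) y))
      (P.divLin (Module.finrank ℝ E) e) := by
  have c3 := P.hasCompactSupport_bump (k := 3) (by simp) one_pos 0
  have c2 := P.hasCompactSupport_bump (k := 2) (by simp) one_pos 0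
  have d3 := P.contDiff_bump 1 1 0
  have d2 := P.contDiff_bump 0 1 0
  have dθ : ContDiff ℝ 1 fun y => -6 * ⟪e, y⟫ * P.bump 2 1 0 y :=
    (contDiff_const.mul (contDiff_const.inner ℝ contDiff_id)).mul d2
  have cθ : HasCompactSupport fun y => -6 * ⟪e, y⟫ * P.bump 2 1 0 y := c2.mul_left
  have h1 := isWeakDiv_smul_const (μ := μ) d3 c3 (P.A e)
  have h2 := isWeakDiv_smul_sub (μ := μ) dθ cθ 0
  have e1 : ∀ y, ⟪gradient (P.bump 3 1 0) y, P.A e⟫ = -6 * ⟪e, y⟫ * P.bump 2 1 0 y := by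
    intro y
    rw [P.gradient_bump 1, inner_smul_left, ← P.symm_A, P.A_B, real_inner_comm]
    simp
    ring
  have e2 : ∀ y, ⟪gradient (fun y => -6 * ⟪e, y⟫ * P.bump 2 1 0 y) y, y - 0⟫ =
      -6 * ⟪e, y⟫ * (P.bump 2 1 0 y - 4 * P.q y * P.bump 1 1 0 y) := by
    intro y
    rw [inner_gradient_left,
      (((hasFDerivAt_inner_left e y).const_mul (-6)).fun_mul (P.hasFDerivAt_bump 0 1 0 y)).fderiv]
    simp only [_root_.add_apply, q,
      _root_.smul_apply, smul_eq_mul, innerSL_apply_apply, sub_zero]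
    norm_num
    ring
  simp only [e1, e2] at h1 h2
  have h3 := h1.add h2 ?_ ?_ ?_ ?_ ?_ ?_
  · convert h3 using 1
    · funext y
      rw [P.gradient_inner_mul_bump 1, map_add, map_smul, map_smul, P.A_B, sub_zero]
      norm_num
    · funext y
      simp only [divLin]
      ring
  · exact (d3.continuous.smul continuous_const).integrable_of_hasCompactSupport c3.smul_right
  · exact (dθ.continuous.smul (continuous_id.sub continuous_const)).integrable_of_hasCompactSupport
      cθ.smul_right
  · fun_prop
  · fun_prop
  · exact cθ
  · have : HasCompactSupport fun y => -6 * ⟪e, y⟫ * P.bump 1 1 0 y :=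
      (P.hasCompactSupport_bump (k := 1) (by simp) one_pos 0).mul_left
    have c4 : HasCompactSupport fun y => (Module.finrank ℝ E + 1 : ℝ) *
      (-6 * ⟪e, y⟫ * P.bump 2 1 0 y) + (-4 * P.q y) * (-6 * ⟪e, y⟫ * P.bump 1 1 0 y) :=
      (HasCompactSupport.mul_left cθ).add (HasCompactSupport.mul_left this)
    convert c4 using 2
    ring

end FrozenCoeff

namespace FrozenCoeff

variable {E : Type*} [NormedAddCommGroup E] [InnerProductSpace ℝ E] (P : FrozenCoeff E)

lemma hasDerivAt_pow_mul_bump (m k : ℕ) (x y : E) (σ : ℝ) :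
    HasDerivAt (fun σ => σ ^ m * P.bump (k + 2) σ x y)
      (m * σ ^ (m - 1) * P.bump (k + 2) σ x y -
        2 * (k + 2) * σ ^ (m + 1) * P.q (y - x) * P.bump (k + 1) σ x y) σ := by
  have h1 : HasDerivAt (fun σ : ℝ => σ ^ 2 * P.q (y - x)) (2 * σ * P.q (y - x)) σ := by
    simpa using (hasDerivAt_pow 2 σ).mul_const (P.q (y - x))
  have h2 := (hasDerivAt_pow m σ).fun_mul ((hasDerivAt_cutPow k _).comp σ h1)
  refine h2.congr_deriv ?_
  simp only [bump, Function.comp]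
  ring

variable [FiniteDimensional ℝ E] [MeasurableSpace E] [BorelSpace E] {μ : Measure E}
  [IsFiniteMeasureOnCompacts μ]

lemma integrable_mul_bump {w : E → ℝ} (hw : Continuous w) {k : ℕ} (hk : k ≠ 0) {σ : ℝ}
    (hσ : 0 < σ) (x : E) : Integrable (fun y => w y * P.bump k σ x y) μ :=
  (hw.mul (P.continuous_bump k σ x)).integrable_of_hasCompactSupport
    (P.hasCompactSupport_bump hk hσ x).mul_left

lemma hasDerivAt_integral_bump {w : E → ℝ} (hw : Continuous w) (m k : ℕ) (x : E) {σ : ℝ}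
    (hσ : 0 < σ) :
    HasDerivAt (fun σ => ∫ y, w y * (σ ^ m * P.bump (k + 2) σ x y) ∂μ)
      (∫ y, w y * (m * σ ^ (m - 1) * P.bump (k + 2) σ x y -
        2 * (k + 2) * σ ^ (m + 1) * P.q (y - x) * P.bump (k + 1) σ x y) ∂μ) σ := by
  set F' : ℝ → E → ℝ := fun σ y => w y * (m * σ ^ (m - 1) * P.bump (k + 2) σ x y -
        2 * (k + 2) * σ ^ (m + 1) * P.q (y - x) * P.bump (k + 1) σ x y) with hF'
  set Q : Set E := closedBall 0 ((σ / 2)⁻¹ * (√P.b)⁻¹ + ‖x‖)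
  have hcont : Continuous (Function.uncurry F') := by
    simp only [hF', bump, Function.uncurry_def]
    fun_prop
  obtain ⟨C, hC⟩ := (isCompact_Icc.prod (isCompact_closedBall (0 : E)
    ((σ / 2)⁻¹ * (√P.b)⁻¹ + ‖x‖)) : IsCompact (Icc (σ / 2) (2 * σ) ×ˢ Q)).exists_bound_of_continuousOn
      hcont.continuousOn
  have hzero : ∀ (j : ℕ), ∀ τ ∈ Icc (σ / 2) (2 * σ), ∀ y ∉ Q, P.bump (j + 1) τ x y = 0 := by
    intro j τ hτ y hy
    by_contra h
    have hτ0 : 0 < τ := by have := hτ.1; linarith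
    refine hy (closedBall_subset_closedBall ?_ (P.support_bump_subset (by simp) hτ0 x h))
    gcongr
    exact hτ.1
  have hs : Icc (σ / 2) (2 * σ) ∈ 𝓝 σ := Icc_mem_nhds (by linarith) (by linarith)
  refine (hasDerivAt_integral_of_dominated_loc_of_deriv_le (μ := μ) (F' := F')
    (F := fun σ y => w y * (σ ^ m * P.bump (k + 2) σ x y)) 
    (bound := Q.indicator fun _ => C) hs ?_ ?_ ?_ ?_ ?_ ?_).2
  · refine Eventually.of_forall fun τ => Continuous.aestronglyMeasurable ?_
    fun_prop
  · have := P.integrable_mul_bump (μ := μ) (hw.mul_const (σ ^ m)) (k := k + 2) (by simp) hσ x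
    simpa only [mul_assoc] using this
  · exact (hcont.comp (by fun_prop : Continuous fun y : E => (σ, y))).aestronglyMeasurable
  · refine ae_of_all _ fun y τ hτ => ?_
    by_cases hy : y ∈ Q
    · rw [indicator_of_mem hy]
      exact hC (τ, y) ⟨hτ, hy⟩
    · rw [indicator_of_notMem hy]
      simp [hF', hzero k τ hτ y hy, hzero (k + 1) τ hτ y hy]
  · exact (integrable_indicator_iff isClosed_closedBall.measurableSet).2
      (integrableOn_const (isCompact_closedBall _ _).measure_lt_top.ne)
  · exact ae_of_all _ fun y τ _ => (P.hasDerivAt_pow_mul_bump m k x y τ).const_mul (w y)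

end FrozenCoeff

section Rescale

variable {E : Type*} [NormedAddCommGroup E] [InnerProductSpace ℝ E]

/-- The blow-up `y ↦ v (r y) / r`. -/
def rescale (v : E → ℝ) (r : ℝ) (y : E) : ℝ := r⁻¹ * v (r • y)

lemma LipschitzWith.rescale {v : E → ℝ} {L : ℝ≥0} (hv : LipschitzWith L v) {r : ℝ} (hr : r ≠ 0) :
    LipschitzWith L (rescale v r) := by
  refine LipschitzWith.of_dist_le_mul fun x y => ?_
  have h := hv.dist_le_mul (r • x) (r • y)
  rw [dist_smul₀, Real.dist_eq, Real.norm_eq_abs] at h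
  rw [Real.dist_eq, _root_.rescale, _root_.rescale, ← mul_sub, abs_mul, abs_inv]
  calc |r|⁻¹ * |v (r • x) - v (r • y)| ≤ |r|⁻¹ * (L * (|r| * dist x y)) := by gcongr
    _ = L * dist x y := by
      have : |r| ≠ 0 := abs_ne_zero.2 hr
      field_simp

lemma rescale_mul (v : E → ℝ) (r : ℝ) {s : ℝ} (hs : s ≠ 0) (y : E) :
    rescale v r (s • y) = s * rescale v (r * s) y := by
  simp only [rescale, mul_inv, smul_smul]
  field_simp

variable [FiniteDimensional ℝ E]

lemma gradient_rescale (v : E → ℝ) {r : ℝ} (hr : r ≠ 0) (y : E) :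
    gradient (rescale v r) y = gradient v (r • y) := by
  have h1 : rescale v r = r⁻¹ • fun y => v (r • y) := rfl
  rw [gradient, gradient, h1, fderiv_const_smul_field, Pi.smul_apply, fderiv_comp_smul,
    smul_smul, inv_mul_cancel₀ hr, one_smul]

lemma gradient_comp_add_right (v : E → ℝ) (a y : E) :
    gradient (fun y => v (y + a)) y = gradient v (y + a) := by
  rw [gradient, gradient, fderiv_comp_add_right]

lemma gradient_eq_zero_of_isLocalMin {v : E → ℝ} {y : E} (h : IsLocalMin v y) :
    gradient v y = 0 := by
  rw [gradient, h.fderiv_eq_zero, map_zero]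

lemma lipschitzWith_of_norm_gradient_le {Φ : E → ℝ} (hΦ : Differentiable ℝ Φ) {S : ℝ≥0}
    (h : ∀ y, ‖gradient Φ y‖ ≤ S) : LipschitzWith S Φ := by
  refine lipschitzWith_of_nnnorm_fderiv_le (𝕜 := ℝ) hΦ fun y => ?_
  have := h y
  rwa [gradient, LinearIsometryEquiv.norm_map] at this

lemma abs_integral_le_of_closedBall [MeasurableSpace E] {μ : Measure E}
    [IsFiniteMeasureOnCompacts μ] {g : E → ℝ} {R C : ℝ}
    (h1 : ∀ y ∈ closedBall (0 : E) R, |g y| ≤ C) (h2 : ∀ y ∉ closedBall (0 : E) R, g y = 0) :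
    |∫ y, g y ∂μ| ≤ C * μ.real (closedBall 0 R) := by
  rw [← setIntegral_eq_integral_of_forall_compl_eq_zero h2]
  exact norm_setIntegral_le_of_norm_le_const (f := g) (isCompact_closedBall _ _).measure_lt_top h1

end Rescale

/-- A nonnegative Lipschitz function vanishing on an exterior ball tangent to `⟪e, ·⟫ = 0` at `0`,
which is a weak subsolution in the unit ball for a coefficient field that is Hölder at `0`. -/
structure IsExteriorSubsol {E : Type*} [NormedAddCommGroup E] [InnerProductSpace ℝ E]
    [FiniteDimensional ℝ E] [MeasurableSpace E] (μ : Measure E) (P : FrozenCoeff E) (e : E)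
    (a : E → E →L[ℝ] E) (L : ℝ≥0) (ρ K γ M : ℝ) (v : E → ℝ) : Prop where
  norm_e : ‖e‖ = 1
  rho_pos : 0 < ρ
  K_nonneg : 0 ≤ K
  gamma_pos : 0 < γ
  gamma_lt : γ < 1
  M_nonneg : 0 ≤ M
  lipschitz : LipschitzWith L v
  nonneg : ∀ x, 0 ≤ v x
  map_zero : v 0 = 0
  eq_zero : ∀ x, ‖x‖ < 1 → ‖x‖ ^ 2 + 2 * ρ * ⟪e, x⟫ < 0 → v x = 0
  measurable : StronglyMeasurable a
  holder : ∀ x, ‖a x - P.A‖ ≤ K * ‖x‖ ^ γ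
  subsol : ∀ (Ψ : E → ℝ) (C : ℝ≥0), LipschitzWith C Ψ → (∀ x, 0 ≤ Ψ x) → tsupport Ψ ⊆ ball 0 1 →
    ∫ x, ⟪a x (gradient v x), gradient Ψ x⟫ ∂μ ≤ M * ∫ x, Ψ x ∂μ

namespace IsExteriorSubsol

variable {E : Type*} [NormedAddCommGroup E] [InnerProductSpace ℝ E]
    [FiniteDimensional ℝ E] [MeasurableSpace E] {μ : Measure E} {P : FrozenCoeff E} {e : E}
    {a : E → E →L[ℝ] E} {L : ℝ≥0} {ρ K γ M : ℝ} {v : E → ℝ}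

lemma rescale_nonneg (h : IsExteriorSubsol μ P e a L ρ K γ M v) {r : ℝ} (hr : 0 < r) (y : E) :
    0 ≤ rescale v r y := mul_nonneg (inv_pos.2 hr).le (h.nonneg _)

lemma rescale_zero (h : IsExteriorSubsol μ P e a L ρ K γ M v) (r : ℝ) :
    rescale v r 0 = 0 := by simp [rescale, h.map_zero]

lemma rescale_le (h : IsExteriorSubsol μ P e a L ρ K γ M v) {r : ℝ} (hr : 0 < r) (y : E) :
    rescale v r y ≤ L * ‖y‖ := by
  have := (h.lipschitz.rescale hr.ne').dist_le_mul y 0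
  rw [h.rescale_zero, dist_zero_right, dist_zero_right] at this
  exact (le_abs_self _).trans this

lemma rescale_eq_zero (h : IsExteriorSubsol μ P e a L ρ K γ M v) {r : ℝ} (hr : 0 < r) {y : E}
    (h1 : r * ‖y‖ < 1) (h2 : r * ‖y‖ ^ 2 + 2 * ρ * ⟪e, y⟫ < 0) : rescale v r y = 0 := by
  rw [rescale, h.eq_zero, mul_zero]
  · rwa [norm_smul, Real.norm_eq_abs, abs_of_pos hr]
  · rw [norm_smul, Real.norm_eq_abs, abs_of_pos hr, inner_smul_right]
    have := mul_neg_of_pos_of_neg hr h2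
    linarith

variable [BorelSpace E] [μ.IsAddHaarMeasure]

lemma integral_rescale_le (h : IsExteriorSubsol μ P e a L ρ K γ M v) {r R : ℝ} (hr : 0 < r)
    (hR : r * R < 1) {Ψ : E → ℝ} {C : ℝ≥0} (hΨ : LipschitzWith C Ψ) (h0 : ∀ y, 0 ≤ Ψ y)
    (hs : Function.support Ψ ⊆ closedBall 0 R) :
    ∫ y, ⟪a (r • y) (gradient (rescale v r) y), gradient Ψ y⟫ ∂μ ≤ M * r * ∫ y, Ψ y ∂μ := by
  have hr' : r⁻¹ ≠ 0 := inv_ne_zero hr.ne'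
  have h1 := h.subsol (rescale Ψ r⁻¹) C (hΨ.rescale hr')
    (fun x => mul_nonneg (by positivity) (h0 _)) ?_
  · have e1 : ∀ y, ⟪a (r • y) (gradient (rescale v r) y), gradient Ψ y⟫ =
        (fun x => ⟪a x (gradient v x), gradient (rescale Ψ r⁻¹) x⟫) (r • y) := by
      intro y
      simp only [gradient_rescale v hr.ne', gradient_rescale Ψ hr', smul_smul,
        inv_mul_cancel₀ hr.ne', one_smul]
    have e2 : ∀ y, Ψ y = r⁻¹ * (fun x => rescale Ψ r⁻¹ x) (r • y) := by
      intro y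
      simp only [rescale, smul_smul, inv_mul_cancel₀ hr.ne', one_smul, inv_inv]
      field_simp
    have c1 := Measure.integral_comp_smul μ
      (fun x => ⟪a x (gradient v x), gradient (rescale Ψ r⁻¹) x⟫) r
    have c2 := Measure.integral_comp_smul μ (fun x => rescale Ψ r⁻¹ x) r
    rw [integral_congr_ae (ae_of_all μ e1), c1, integral_congr_ae (ae_of_all μ e2),
      integral_const_mul, c2, mul_assoc, mul_inv_cancel_left₀ hr.ne', smul_eq_mul, smul_eq_mul,
      mul_left_comm]
    exact mul_le_mul_of_nonneg_left h1 (abs_nonneg _)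
  · have h2 : Function.support (rescale Ψ r⁻¹) ⊆ closedBall 0 (r * R) := by
      intro x hx
      have h3 : Ψ (r⁻¹ • x) ≠ 0 := fun h4 => hx (by simp [rescale, h4])
      have := hs h3
      rw [mem_closedBall_zero_iff, norm_smul, norm_inv, Real.norm_eq_abs, abs_of_pos hr] at this
      rw [mem_closedBall_zero_iff]
      rwa [inv_mul_le_iff₀ hr] at this
    exact (closure_minimal h2 isClosed_closedBall).trans (closedBall_subset_ball hR)

lemma integral_frozen_le (h : IsExteriorSubsol μ P e a L ρ K γ M v) {r R : ℝ} (hr : 0 < r)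
    (hR : r * R < 1) {Ψ : E → ℝ} {C : ℝ≥0} (hΨ : LipschitzWith C Ψ) (h0 : ∀ y, 0 ≤ Ψ y)
    (hs : Function.support Ψ ⊆ closedBall 0 R) :
    ∫ y, ⟪P.A (gradient (rescale v r) y), gradient Ψ y⟫ ∂μ ≤ M * r * ∫ y, Ψ y ∂μ +
      K * (r * R) ^ γ * L * C * μ.real (closedBall 0 R) := by
  have hg : ∀ y ∉ closedBall (0 : E) R, gradient Ψ y = 0 := by
    intro y hy
    have : Ψ =ᶠ[𝓝 y] fun _ => 0 := by
      filter_upwards [isClosed_closedBall.isOpen_compl.mem_nhds hy] with z hz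
      by_contra hne
      exact hz (hs hne)
    rw [this.gradient_eq]
    simp [gradient]
  have hgi : Integrable (gradient Ψ) μ := by
    have hi : Integrable ((closedBall (0 : E) R).indicator fun _ => (C : ℝ)) μ :=
      (integrable_indicator_iff isClosed_closedBall.measurableSet).2
        (integrableOn_const (isCompact_closedBall _ _).measure_lt_top.ne)
    refine hi.mono' (stronglyMeasurable_gradient Ψ).aestronglyMeasurable (ae_of_all _ fun y => ?_)
    by_cases hy : y ∈ closedBall (0 : E) R
    · rw [indicator_of_mem hy]; exact norm_gradient_le_of_lipschitzWith hΨ y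
    · rw [hg y hy]; simp [hy]
  have hvr := h.lipschitz.rescale hr.ne'
  have hvb := fun y => norm_gradient_le_of_lipschitzWith hvr y
  have hm : StronglyMeasurable fun y => a (r • y) :=
    h.measurable.comp_measurable (measurable_const_smul r)
  have bnd : ∀ y, ‖⟪(a (r • y) - P.A) (gradient (rescale v r) y), gradient Ψ y⟫‖ ≤
      K * (r * ‖y‖) ^ γ * L * ‖gradient Ψ y‖ := by
    intro y
    refine (norm_inner_le_norm _ _).trans ?_
    have h1 := h.holder (r • y)
    rw [norm_smul, Real.norm_eq_abs, abs_of_pos hr] at h1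
    gcongr
    refine (ContinuousLinearMap.le_opNorm _ _).trans ?_
    gcongr
    · exact mul_nonneg h.K_nonneg (by positivity)
    · exact hvb y
  have i1 : Integrable (fun y => ⟪P.A (gradient (rescale v r) y), gradient Ψ y⟫) μ := by
    simp only [P.symm_A]
    exact integrable_inner_gradient hvr (P.A.integrable_comp hgi)
  have i2 : Integrable (fun y => ⟪(a (r • y) - P.A) (gradient (rescale v r) y), gradient Ψ y⟫) μ := by
    refine (hgi.norm.const_mul (K * (r * R) ^ γ * L)).mono' ?_ (ae_of_all _ fun y => ?_)
    · refine (StronglyMeasurable.inner ?_ (stronglyMeasurable_gradient Ψ)).aestronglyMeasurable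
      exact isBoundedBilinearMap_apply.continuous.comp_stronglyMeasurable
        ((hm.sub stronglyMeasurable_const).prodMk (stronglyMeasurable_gradient _))
    · refine (bnd y).trans ?_
      by_cases hy : y ∈ closedBall (0 : E) R
      · rw [mem_closedBall_zero_iff] at hy
        have := h.K_nonneg
        have := h.gamma_pos.le
        gcongr
      · rw [hg y hy]; simp
  have h2 : |∫ y, ⟪(a (r • y) - P.A) (gradient (rescale v r) y), gradient Ψ y⟫ ∂μ| ≤
      K * (r * R) ^ γ * L * C * μ.real (closedBall 0 R) := by
    refine abs_integral_le_of_closedBall (fun y hy => (bnd y).trans ?_) fun y hy => by simp [hg y hy]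
    rw [mem_closedBall_zero_iff] at hy
    have := h.K_nonneg
    have := h.gamma_pos.le
    have := (norm_nonneg y).trans hy
    gcongr
    exact norm_gradient_le_of_lipschitzWith hΨ y
  have h3 := h.integral_rescale_le hr hR hΨ h0 hs
  have e1 : ∀ y, ⟪a (r • y) (gradient (rescale v r) y), gradient Ψ y⟫ =
      ⟪P.A (gradient (rescale v r) y), gradient Ψ y⟫ +
        ⟪(a (r • y) - P.A) (gradient (rescale v r) y), gradient Ψ y⟫ := by
    intro y
    rw [← inner_add_left]; simp
  simp only [e1] at h3
  rw [integral_add i1 i2] at h3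
  linarith [neg_le_of_abs_le h2]

end IsExteriorSubsol

/-- A compactly supported potential which is positive on one side of the hyperplane `⟪e, ·⟫ = 0` and
negative on the other, with `ℓ` the divergence of `A ∇ Φ`; all sizes are controlled by `S`. -/
structure IsHalfPotential {E : Type*} [NormedAddCommGroup E] [InnerProductSpace ℝ E]
    [FiniteDimensional ℝ E] [MeasurableSpace E] (μ : Measure E) (P : FrozenCoeff E) (e : E)
    (R : ℝ) (S : ℝ≥0) (Φ ℓ : E → ℝ) : Prop where
  contDiff : ContDiff ℝ 1 Φ
  support : Function.support Φ ⊆ closedBall 0 R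
  nonneg : ∀ y, 0 ≤ ⟪e, y⟫ → 0 ≤ Φ y
  le : ∀ y, Φ y ≤ S
  gradient_le : ∀ y, ‖gradient Φ y‖ ≤ S
  continuous_div : Continuous ℓ
  support_div : Function.support ℓ ⊆ closedBall 0 R
  div_le : ∀ y, |ℓ y| ≤ S
  isWeakDiv : IsWeakDiv μ (fun y => P.A (gradient Φ y)) ℓ

namespace IsExteriorSubsol

variable {E : Type*} [NormedAddCommGroup E] [InnerProductSpace ℝ E]
    [FiniteDimensional ℝ E] [MeasurableSpace E] [BorelSpace E] {μ : Measure E}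
    [μ.IsAddHaarMeasure] {P : FrozenCoeff E} {e : E}
    {a : E → E →L[ℝ] E} {L : ℝ≥0} {ρ K γ M : ℝ} {v : E → ℝ}

lemma exists_le_integral_rescale (h : IsExteriorSubsol μ P e a L ρ K γ M v) {R : ℝ} (hR : 0 < R) :
    ∃ C, 0 ≤ C ∧ ∀ᶠ r in 𝓝[>] (0 : ℝ), ∀ (S : ℝ≥0) (Φ ℓ : E → ℝ), IsHalfPotential μ P e R S Φ ℓ →
      -(C * S * r ^ γ) ≤ ∫ y, rescale v r y * ℓ y ∂μ := by
  have hρ := h.rho_pos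
  set κ₀ : ℝ := (R + 1) ^ 2 / (2 * ρ) + 1 with hκ₀
  have hκ₀pos : 0 < κ₀ := by positivity
  set V := μ.real (closedBall (0 : E) (R + 1))
  have hV : 0 ≤ V := measureReal_nonneg
  have hK := h.K_nonneg
  have hM := h.M_nonneg
  refine ⟨V * (M + K * (R + 1) ^ γ * L + L * κ₀), by positivity, ?_⟩
  have hev : ∀ᶠ r in 𝓝[>] (0 : ℝ), r < 1 ∧ κ₀ * r < 1 ∧ r * (R + 1) < 1 := by
    have t1 : Tendsto (fun r : ℝ => r) (𝓝[>] 0) (𝓝 0) := nhdsWithin_le_nhds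
    have t2 : Tendsto (fun r : ℝ => κ₀ * r) (𝓝[>] 0) (𝓝 0) := by simpa using t1.const_mul κ₀
    have t3 : Tendsto (fun r : ℝ => r * (R + 1)) (𝓝[>] 0) (𝓝 0) := by
      simpa using t1.mul_const (R + 1)
    exact (t1.eventually_lt_const one_pos).and
      ((t2.eventually_lt_const one_pos).and (t3.eventually_lt_const one_pos))
  filter_upwards [hev, self_mem_nhdsWithin] with r hr hr0 S Φ ℓ hΦ
  obtain ⟨hr1, hκ1, hrR⟩ := hr
  have hr0 : 0 < r := hr0
  set κ := κ₀ * r with hκ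
  have hκ0 : 0 < κ := by positivity
  have he2 : ⟪e, e⟫ = 1 := by rw [real_inner_self_eq_norm_sq, h.norm_e]; norm_num
  have hnκ : ‖κ • e‖ = κ := by rw [norm_smul, h.norm_e, mul_one, Real.norm_eq_abs, abs_of_pos hκ0]
  have hvr := h.lipschitz.rescale hr0.ne'
  have hvz : ∀ y : E, ‖y‖ ≤ R + 1 → ⟪e, y⟫ ≤ -κ → rescale v r y = 0 := by
    intro y hy hy1
    refine h.rescale_eq_zero hr0 (lt_of_le_of_lt (by gcongr) hrR) ?_
    have h1 : r * ‖y‖ ^ 2 ≤ r * (R + 1) ^ 2 := by gcongr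
    have h2 : 2 * ρ * κ = r * (R + 1) ^ 2 + 2 * ρ * r := by rw [hκ, hκ₀]; field_simp
    have h3 : 2 * ρ * ⟪e, y⟫ ≤ 2 * ρ * (-κ) := by gcongr
    have h4 : 0 < 2 * ρ * r := by positivity
    linarith
  set Φκ : E → ℝ := fun y => Φ (y + κ • e) with hΦκ
  set Ψ : E → ℝ := fun y => max (Φκ y) 0 with hΨ
  have hΦs : ∀ y, R + 1 < ‖y‖ → Φκ y = 0 := by
    intro y hy
    by_contra hne
    have h1 := hΦ.support (show Φ (y + κ • e) ≠ 0 from hne)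
    rw [mem_closedBall_zero_iff] at h1
    have h2 : ‖y‖ ≤ ‖y + κ • e‖ + ‖κ • e‖ := by
      simpa using norm_sub_le (y + κ • e) (κ • e)
    linarith
  have hΦL : LipschitzWith S Φ :=
    lipschitzWith_of_norm_gradient_le (hΦ.contDiff.differentiable one_ne_zero) hΦ.gradient_le
  have hΦκL : LipschitzWith S Φκ := by
    refine LipschitzWith.of_dist_le_mul fun x y => ?_
    simpa using hΦL.dist_le_mul (x + κ • e) (y + κ • e)
  have hΨL : LipschitzWith S Ψ := hΦκL.max_const 0
  have hinner : ∀ y : E, ⟪e, y + κ • e⟫ = ⟪e, y⟫ + κ := by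
    intro y; rw [inner_add_right, inner_smul_right, he2, mul_one]
  have hgrad : ∀ y, ⟪P.A (gradient (rescale v r) y), gradient Ψ y⟫ =
      ⟪P.A (gradient (rescale v r) y), gradient Φκ y⟫ := by
    intro y
    rcases lt_or_ge (R + 1) ‖y‖ with hy | hy
    · have : Ψ =ᶠ[𝓝 y] Φκ := by
        filter_upwards [(isOpen_lt continuous_const continuous_norm).mem_nhds hy] with z hz
        simp only [hΨ, hΦs z hz, max_self]
      rw [this.gradient_eq]
    · rcases le_or_gt ⟪e, y⟫ (-κ) with hy1 | hy1
      · have hmin : IsLocalMin (rescale v r) y := by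
          refine Eventually.of_forall fun z => ?_
          rw [hvz y hy hy1]
          exact h.rescale_nonneg hr0 z
        rw [gradient_eq_zero_of_isLocalMin hmin]
        simp
      · have : Ψ =ᶠ[𝓝 y] Φκ := by
          have ho : IsOpen {z : E | -κ < ⟪e, z⟫} :=
            isOpen_lt continuous_const (continuous_const.inner continuous_id)
          filter_upwards [ho.mem_nhds hy1] with z hz
          refine max_eq_left (hΦ.nonneg _ ?_)
          rw [hinner]
          have : -κ < ⟪e, z⟫ := hz
          linarith
        rw [this.gradient_eq]
  set w : E → ℝ := fun y => rescale v r (y + -(κ • e)) with hw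
  have hwL : LipschitzWith L w := by
    refine LipschitzWith.of_dist_le_mul fun x y => ?_
    simpa using hvr.dist_le_mul (x + -(κ • e)) (y + -(κ • e))
  have key1 : ∫ y, ⟪P.A (gradient (rescale v r) y), gradient Ψ y⟫ ∂μ = - ∫ y, w y * ℓ y ∂μ := by
    rw [← hΦ.isWeakDiv w L hwL, ← integral_add_right_eq_self
      (fun y => ⟪gradient w y, P.A (gradient Φ y)⟫) (κ • e)]
    refine integral_congr_ae (ae_of_all _ fun y => ?_)
    simp only [hgrad, hw, gradient_comp_add_right, add_neg_cancel_right, P.symm_A, hΦκ]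
  have hΨs : Function.support Ψ ⊆ closedBall 0 (R + 1) := by
    intro y hy
    by_contra hne
    rw [mem_closedBall_zero_iff, not_le] at hne
    exact hy (by simp [hΨ, hΦs y hne])
  have key2 := h.integral_frozen_le hr0 hrR hΨL (fun y => le_max_right _ _) hΨs
  have key3 : ∫ y, Ψ y ∂μ ≤ S * V := by
    refine (le_abs_self _).trans (abs_integral_le_of_closedBall (fun y _ => ?_) fun y hy => ?_)
    · rw [abs_of_nonneg (le_max_right _ _)]
      exact max_le (hΦ.le _) S.2
    · by_contra hne; exact hy (hΨs hne)
  have hℓs : ∀ y ∉ closedBall (0 : E) (R + 1), ℓ y = 0 := by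
    intro y hy
    by_contra hne
    exact hy (closedBall_subset_closedBall (by linarith) (hΦ.support_div hne))
  have hℓc : HasCompactSupport ℓ :=
    HasCompactSupport.of_support_subset_isCompact (isCompact_closedBall _ _) hΦ.support_div
  have key4 : |∫ y, (rescale v r y - w y) * ℓ y ∂μ| ≤ L * κ * S * V := by
    refine abs_integral_le_of_closedBall (fun y _ => ?_) fun y hy => by rw [hℓs y hy, mul_zero]
    rw [abs_mul]
    refine mul_le_mul ?_ (hΦ.div_le y) (abs_nonneg _) (by positivity)
    have := hvr.dist_le_mul y (y + -(κ • e))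
    rw [Real.dist_eq, dist_eq_norm] at this
    refine this.trans (le_of_eq ?_)
    simp [hnκ]
  have key5 : ∫ y, (rescale v r y - w y) * ℓ y ∂μ =
      ∫ y, rescale v r y * ℓ y ∂μ - ∫ y, w y * ℓ y ∂μ := by
    simp only [sub_mul]
    exact integral_sub
      ((hvr.continuous.mul hΦ.continuous_div).integrable_of_hasCompactSupport hℓc.mul_left)
      ((hwL.continuous.mul hΦ.continuous_div).integrable_of_hasCompactSupport hℓc.mul_left)
  have hrγ : r ≤ r ^ γ := by
    conv_lhs => rw [← Real.rpow_one r]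
    exact Real.rpow_le_rpow_of_exponent_ge hr0 hr1.le h.gamma_lt.le
  have e1 : (r * (R + 1)) ^ γ = r ^ γ * (R + 1) ^ γ := Real.mul_rpow hr0.le (by positivity)
  rw [key1, e1] at key2
  rw [key5] at key4
  have b1 : M * r * ∫ y, Ψ y ∂μ ≤ M * r ^ γ * (S * V) := by
    refine (mul_le_mul_of_nonneg_left key3 (by positivity)).trans ?_
    gcongr
  have b2 : L * κ * S * V ≤ L * (κ₀ * r ^ γ) * S * V := by rw [hκ]; gcongr
  have := neg_le_of_abs_le key4
  linarith

end IsExteriorSubsol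

namespace FrozenCoeff

variable {E : Type*} [NormedAddCommGroup E] [InnerProductSpace ℝ E] (P : FrozenCoeff E)

@[fun_prop]
lemma continuous_divLin (d : ℝ) (e : E) : Continuous (P.divLin d e) := by
  unfold divLin; fun_prop

lemma support_divLin_subset (d : ℝ) (e : E) :
    Function.support (P.divLin d e) ⊆ closedBall 0 (√P.b)⁻¹ := by
  intro y hy
  have h1 : P.bump 2 1 0 y ≠ 0 ∨ P.bump 1 1 0 y ≠ 0 := by
    by_contra! h
    exact hy (by simp [divLin, h.1, h.2])
  have h2 : ∀ k, k ≠ 0 → P.bump k 1 0 y ≠ 0 → y ∈ closedBall 0 (√P.b)⁻¹ := by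
    intro k hk h
    simpa using P.support_bump_subset hk one_pos 0 h
  rcases h1 with h | h
  exacts [h2 2 (by simp) h, h2 1 (by simp) h]

variable [FiniteDimensional ℝ E]

lemma continuous_gradient {Φ : E → ℝ} (h : ContDiff ℝ 1 Φ) : Continuous (gradient Φ) :=
  (InnerProductSpace.toDual ℝ E).symm.continuous.comp (h.continuous_fderiv one_ne_zero)

lemma hasCompactSupport_gradient {Φ : E → ℝ} (h : HasCompactSupport Φ) :
    HasCompactSupport (gradient Φ) :=
  (h.fderiv ℝ).comp_left (map_zero _)

lemma exists_isHalfPotential_lin [MeasurableSpace E] [BorelSpace E] {μ : Measure E}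
    [μ.IsAddHaarMeasure] (e : E) :
    ∃ S : ℝ≥0, IsHalfPotential μ P e (√P.b)⁻¹ S (fun y => ⟪e, y⟫ * P.bump 3 1 0 y)
      (P.divLin (Module.finrank ℝ E) e) := by
  have hd : ContDiff ℝ 1 fun y => ⟪e, y⟫ * P.bump 3 1 0 y :=
    (contDiff_const.inner ℝ contDiff_id).mul (P.contDiff_bump 1 1 0)
  have hc : HasCompactSupport fun y => ⟪e, y⟫ * P.bump 3 1 0 y :=
    (P.hasCompactSupport_bump (by simp) one_pos 0).mul_left
  obtain ⟨C₁, h₁⟩ := hc.exists_bound_of_continuous hd.continuous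
  obtain ⟨C₂, h₂⟩ := (hasCompactSupport_gradient hc).exists_bound_of_continuous
    (continuous_gradient hd)
  have hc3 : HasCompactSupport (P.divLin (Module.finrank ℝ E) e) :=
    HasCompactSupport.of_support_subset_isCompact (isCompact_closedBall _ _)
      (P.support_divLin_subset _ e)
  obtain ⟨C₃, h₃⟩ := hc3.exists_bound_of_continuous (P.continuous_divLin _ e)
  have hS := Real.le_coe_toNNReal (max C₁ (max C₂ C₃))
  refine ⟨Real.toNNReal (max C₁ (max C₂ C₃)), hd, ?_, ?_, ?_, ?_,
    P.continuous_divLin _ e, P.support_divLin_subset _ e, ?_, P.isWeakDiv_lin e⟩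
  · intro y hy
    simpa using P.support_bump_subset (k := 3) (by simp) one_pos 0 (right_ne_zero_of_mul hy)
  · exact fun y hy => mul_nonneg hy (P.bump_nonneg _ _ _ _)
  · exact fun y => (le_abs_self _).trans ((h₁ y).trans ((le_max_left _ _).trans hS))
  · exact fun y => (h₂ y).trans (((le_max_left _ _).trans (le_max_right _ _)).trans hS)
  · exact fun y => (h₃ y).trans (((le_max_right _ _).trans (le_max_right _ _)).trans hS)

end FrozenCoeff

namespace IsExteriorSubsol

variable {E : Type*} [NormedAddCommGroup E] [InnerProductSpace ℝ E]
    [FiniteDimensional ℝ E] [MeasurableSpace E] {μ : Measure E} {P : FrozenCoeff E} {e : E}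
    {a : E → E →L[ℝ] E} {L : ℝ≥0} {ρ K γ M : ℝ} {v : E → ℝ}

/-- The truncated first moment of the blow-up at scale `r`. -/
def moment (μ : Measure E) (P : FrozenCoeff E) (e : E) (v : E → ℝ) (r : ℝ) : ℝ :=
  ∫ y, rescale v r y * (⟪e, y⟫ * P.bump 2 1 0 y) ∂μ

variable [μ.IsAddHaarMeasure]

lemma exists_abs_moment_le (h : IsExteriorSubsol μ P e a L ρ K γ M v) :
    ∃ C, ∀ r, 0 < r → |moment μ P e v r| ≤ C := by
  refine ⟨L * (√P.b)⁻¹ * (√P.b)⁻¹ * μ.real (closedBall 0 (√P.b)⁻¹), fun r hr =>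
    abs_integral_le_of_closedBall (fun y hy => ?_) fun y hy => ?_⟩
  · rw [mem_closedBall_zero_iff] at hy
    have hb := inv_nonneg.2 (Real.sqrt_nonneg P.b)
    rw [abs_mul, abs_mul, abs_of_nonneg (h.rescale_nonneg hr y),
      abs_of_nonneg (P.bump_nonneg _ _ _ _)]
    have h1 : |⟪e, y⟫| ≤ (√P.b)⁻¹ := by
      refine (abs_real_inner_le_norm _ _).trans ?_
      rw [h.norm_e, one_mul]; exact hy
    have h2 : |⟪e, y⟫| * P.bump 2 1 0 y ≤ (√P.b)⁻¹ :=
      (mul_le_of_le_one_right (abs_nonneg _) (P.bump_le_one _ _ _ _)).trans h1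
    have h3 : rescale v r y ≤ L * (√P.b)⁻¹ := (h.rescale_le hr y).trans (by gcongr)
    exact mul_le_mul h3 h2 (mul_nonneg (abs_nonneg _) (P.bump_nonneg _ _ _ _)) (by positivity)
  · by_contra hne
    have := P.support_bump_subset (k := 2) (by simp) one_pos 0
      (right_ne_zero_of_mul (right_ne_zero_of_mul hne))
    exact hy (by simpa using this)

variable [BorelSpace E]

lemma moment_eq {r s : ℝ} (hr : 0 < r) (hs : 0 < s) :
    moment μ P e v r = ∫ y, (rescale v s y * ⟪e, y⟫) *
      ((s / r) ^ (Module.finrank ℝ E + 2) * P.bump 2 (s / r) 0 y) ∂μ := by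
  have hσ : 0 < s / r := div_pos hs hr
  have h1 := Measure.integral_comp_smul_of_nonneg μ
    (fun y => rescale v r y * (⟪e, y⟫ * P.bump 2 1 0 y)) (s / r) (hR := hσ.le)
  have h2 : moment μ P e v r = (s / r) ^ Module.finrank ℝ E *
      ∫ y, rescale v r ((s / r) • y) * (⟪e, (s / r) • y⟫ * P.bump 2 1 0 ((s / r) • y)) ∂μ := by
    rw [h1, smul_eq_mul, mul_inv_cancel_left₀ (by positivity)]; rfl
  rw [h2, ← integral_const_mul]
  refine integral_congr_ae (ae_of_all _ fun y => ?_)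
  have h3 : rescale v r ((s / r) • y) = (s / r) * rescale v s y := by
    rw [rescale_mul v r hσ.ne', mul_div_cancel₀ _ hr.ne']
  simp only [h3, inner_smul_right, FrozenCoeff.bump, sub_zero, P.q_smul]
  ring_nf

lemma hasDerivAt_moment (h : IsExteriorSubsol μ P e a L ρ K γ M v) {r : ℝ} (hr : 0 < r) :
    HasDerivAt (moment μ P e v)
      (6⁻¹ * r⁻¹ * ∫ y, rescale v r y * P.divLin (Module.finrank ℝ E) e y ∂μ) r := by
  have hw : Continuous fun y => rescale v r y * ⟪e, y⟫ :=
    (h.lipschitz.rescale hr.ne').continuous.mul (continuous_const.inner continuous_id)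
  have h1 := P.hasDerivAt_integral_bump (μ := μ) hw (Module.finrank ℝ E + 2) 0 0 one_pos
  have h2 : HasDerivAt (fun t => r / t) (-r⁻¹) r := by
    have := (hasDerivAt_inv hr.ne').const_mul r
    refine this.congr_deriv ?_
    field_simp
  rw [← div_self hr.ne'] at h1
  have h3 := h1.comp r h2
  refine (h3.congr_of_eventuallyEq ?_).congr_deriv ?_
  · filter_upwards [Ioi_mem_nhds hr] with t ht
    exact moment_eq ht hr
  · rw [div_self hr.ne', mul_comm, ← integral_const_mul, ← integral_const_mul]
    refine integral_congr_ae (ae_of_all _ fun y => ?_)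
    simp only [FrozenCoeff.divLin, sub_zero, one_pow]
    push_cast
    ring

lemma exists_tendsto_moment (h : IsExteriorSubsol μ P e a L ρ K γ M v) :
    ∃ N, Tendsto (moment μ P e v) (𝓝[>] 0) (𝓝 N) := by
  obtain ⟨S, hS⟩ := P.exists_isHalfPotential_lin (μ := μ) e
  obtain ⟨C, hC, hev⟩ := h.exists_le_integral_rescale
    (inv_pos.2 (Real.sqrt_pos.2 P.b_pos) : 0 < (√P.b)⁻¹)
  obtain ⟨r₀, hr₀, hsub⟩ := mem_nhdsGT_iff_exists_Ioo_subset.1 hev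
  have hr₀ : 0 < r₀ := hr₀
  have hγ := h.gamma_pos
  set D := 6⁻¹ * (C * S) / γ with hD
  have hDnn : 0 ≤ D := by positivity
  set G : ℝ → ℝ := fun r => moment μ P e v r + D * r ^ γ with hG
  have hder : ∀ r, 0 < r → HasDerivAt G
      (6⁻¹ * r⁻¹ * (∫ y, rescale v r y * P.divLin (Module.finrank ℝ E) e y ∂μ) +
        D * (γ * r ^ (γ - 1))) r := fun r hr =>
    (h.hasDerivAt_moment hr).add ((Real.hasDerivAt_rpow_const (Or.inl hr.ne')).const_mul D)
  have hmono : MonotoneOn G (Ioo 0 r₀) := by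
    refine monotoneOn_of_deriv_nonneg (convex_Ioo _ _)
      (fun r hr => (hder r hr.1).continuousAt.continuousWithinAt)
      (fun r hr => ?_) fun r hr => ?_
    · rw [interior_Ioo] at hr
      exact (hder r hr.1).differentiableAt.differentiableWithinAt
    · rw [interior_Ioo] at hr
      rw [(hder r hr.1).deriv, Real.rpow_sub_one hr.1.ne']
      have h1 := hsub hr S _ _ hS
      have h2 : 0 ≤ 6⁻¹ * r⁻¹ * ((∫ y, rescale v r y * P.divLin (Module.finrank ℝ E) e y ∂μ) +
          C * S * r ^ γ) :=
        mul_nonneg (mul_nonneg (by norm_num) (inv_pos.2 hr.1).le) (by linarith)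
      refine h2.trans (le_of_eq ?_)
      rw [hD]
      field_simp
  obtain ⟨C', hC'⟩ := h.exists_abs_moment_le
  have hbdd : BddBelow (G '' Ioo 0 r₀) := by
    refine ⟨-C', ?_⟩
    rintro _ ⟨r, hr, rfl⟩
    have h1 := neg_le_of_abs_le (hC' r hr.1)
    have h2 : 0 ≤ D * r ^ γ := mul_nonneg hDnn (Real.rpow_nonneg hr.1.le _)
    simp only [hG]
    linarith
  have hlim := hmono.tendsto_nhdsWithin_Ioo_right (nonempty_Ioo.2 hr₀) hbdd
  have hpow : Tendsto (fun r : ℝ => D * r ^ γ) (𝓝[>] 0) (𝓝 0) := by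
    have := ((Real.continuousAt_rpow_const 0 γ (Or.inr hγ.le)).tendsto.const_mul D)
    rw [Real.zero_rpow hγ.ne', mul_zero] at this
    exact this.mono_left nhdsWithin_le_nhds
  refine ⟨_, (hlim.sub hpow).congr fun r => ?_⟩
  simp [hG]

end IsExteriorSubsol

namespace FrozenCoeff

variable {E : Type*} [NormedAddCommGroup E] [InnerProductSpace ℝ E] (P : FrozenCoeff E)

/-- The conormal reflection in the hyperplane `⟪e, ·⟫ = 0`. -/
def reflect (e x : E) : E := x - (2 * ⟪e, x⟫ / P.q (P.A e)) • P.A e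

lemma q_A (e : E) : P.q (P.A e) = ⟪e, P.A e⟫ := by rw [q, P.B_A]

lemma q_A_pos {e : E} (he : e ≠ 0) : 0 < P.q (P.A e) := by
  have h : P.A e ≠ 0 := fun h => he (by rw [← P.B_A e, h, map_zero])
  have := P.b_pos
  have := norm_pos_iff.2 h
  exact lt_of_lt_of_le (by positivity) (P.b_mul_le_q (P.A e))

lemma inner_reflect {e : E} (he : e ≠ 0) (x : E) : ⟪e, P.reflect e x⟫ = -⟪e, x⟫ := by
  have := (P.q_A_pos he).ne'
  rw [reflect, inner_sub_right, inner_smul_right, ← P.q_A]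
  field_simp
  ring

lemma q_sub_reflect {e : E} (he : e ≠ 0) (x y : E) :
    P.q (y - P.reflect e x) = P.q (y - x) + 4 * ⟪e, x⟫ * ⟪e, y⟫ / P.q (P.A e) := by
  have := (P.q_A_pos he).ne'
  have h1 : y - P.reflect e x = (y - x) + (2 * ⟪e, x⟫ / P.q (P.A e)) • P.A e := by
    rw [reflect]; abel
  rw [h1, P.q_add, P.q_smul, inner_smul_right, P.symm_B, P.B_A, inner_sub_left,
    real_inner_comm e y, real_inner_comm e x]
  field_simp
  ring

lemma reflect_smul (e x : E) (s : ℝ) : P.reflect e (s • x) = s • P.reflect e x := by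
  rw [reflect, reflect, smul_sub, smul_smul, inner_smul_right]
  congr 2
  ring

lemma norm_gradient_bump_le [FiniteDimensional ℝ E] {σ : ℝ} (hσ : 0 < σ) (x y : E) :
    ‖gradient (P.bump 4 σ x) y‖ ≤ 8 * σ * ‖P.B‖ * (√P.b)⁻¹ := by
  have hb := inv_nonneg.2 (Real.sqrt_nonneg P.b)
  rw [P.gradient_bump 2, norm_smul, Real.norm_eq_abs]
  by_cases h : P.bump 3 σ x y = 0
  · rw [show (2 : ℕ) + 1 = 3 from rfl, h]
    simp only [mul_zero, abs_zero, zero_mul]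
    positivity
  · have h1 := (P.norm_sub_lt_of_bump_ne_zero (by simp) hσ h).le
    have h2 : |(-2 * ((2 : ℕ) + 2) * σ ^ 2 * P.bump 3 σ x y)| ≤ 8 * σ ^ 2 := by
      rw [abs_mul, abs_of_nonneg (P.bump_nonneg _ _ _ _)]
      have : |(-2 * ((2 : ℕ) + 2) * σ ^ 2 : ℝ)| = 8 * σ ^ 2 := by
        rw [abs_mul, abs_of_nonneg (sq_nonneg σ)]
        norm_num
      rw [this]
      exact mul_le_of_le_one_right (by positivity) (P.bump_le_one _ _ _ _)
    calc _ ≤ 8 * σ ^ 2 * (‖P.B‖ * (σ⁻¹ * (√P.b)⁻¹)) :=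
          mul_le_mul h2 ((P.B.le_opNorm _).trans (by gcongr)) (norm_nonneg _) (by positivity)
      _ = _ := by field_simp

lemma abs_divBump_le {d : ℝ} (hd : 0 ≤ d) (σ : ℝ) (x y : E) :
    |P.divBump d σ x y| ≤ 8 * σ ^ 2 * (d + 6) := by
  have h0 := P.sq_mul_q_nonneg σ (y - x)
  have h1 : σ ^ 2 * P.q (y - x) * P.bump 2 σ x y ≤ 1 := mul_cutPow_le_one (by simp) h0
  have h2 := mul_nonneg h0 (P.bump_nonneg 2 σ x y)
  have h3 := mul_le_of_le_one_right hd (P.bump_le_one 3 σ x y)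
  have h4 := mul_nonneg hd (P.bump_nonneg 3 σ x y)
  have h5 : |(-8 * σ ^ 2)| = 8 * σ ^ 2 := by
    rw [abs_mul, abs_of_nonneg (sq_nonneg σ)]; norm_num
  rw [divBump, abs_mul, h5]
  gcongr
  rw [abs_le]
  constructor <;> linarith

@[fun_prop]
lemma continuous_divBump (d σ : ℝ) (x : E) : Continuous (P.divBump d σ x) := by
  unfold divBump; fun_prop

lemma support_divBump_subset (d : ℝ) {σ : ℝ} (hσ : 0 < σ) (x : E) :
    Function.support (P.divBump d σ x) ⊆ closedBall 0 (σ⁻¹ * (√P.b)⁻¹ + ‖x‖) := by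
  intro y hy
  have h1 : P.bump 3 σ x y ≠ 0 ∨ P.bump 2 σ x y ≠ 0 := by
    by_contra! h
    exact hy (by simp [divBump, h.1, h.2])
  rcases h1 with h | h
  exacts [P.support_bump_subset (by simp) hσ x h, P.support_bump_subset (by simp) hσ x h]

variable [FiniteDimensional ℝ E] [MeasurableSpace E] [BorelSpace E] {μ : Measure E}
  [μ.IsAddHaarMeasure]

lemma exists_isHalfPotential_reflect {e : E} (he : e ≠ 0) {x : E} (hx : 0 ≤ ⟪e, x⟫) {s : ℝ}
    (hs : 0 < s) (T : ℝ) :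
    ∃ R > 0, ∃ S : ℝ≥0, ∀ σ ∈ Icc s T, IsHalfPotential μ P e R S
      (fun y => P.bump 4 σ x y - P.bump 4 σ (P.reflect e x) y)
      (fun y => P.divBump (Module.finrank ℝ E) σ x y -
        P.divBump (Module.finrank ℝ E) σ (P.reflect e x) y) := by
  have hb := inv_pos.2 (Real.sqrt_pos.2 P.b_pos)
  have hc := P.q_A_pos he
  set R := s⁻¹ * (√P.b)⁻¹ + ‖x‖ + ‖P.reflect e x‖ with hR
  set G := 2 * (8 * T * ‖P.B‖ * (√P.b)⁻¹) with hG
  set G' := 2 * (8 * T ^ 2 * ((Module.finrank ℝ E : ℝ) + 6)) with hG'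
  have hS := Real.le_coe_toNNReal (max 1 (max G G'))
  refine ⟨R, by positivity, Real.toNNReal (max 1 (max G G')), fun σ hσ => ?_⟩
  have hσ0 : 0 < σ := hs.trans_le hσ.1
  have hσT := hσ.2
  have hinv : σ⁻¹ ≤ s⁻¹ := inv_anti₀ hs hσ.1
  have hR1 : σ⁻¹ * (√P.b)⁻¹ + ‖x‖ ≤ R := by
    have := norm_nonneg (P.reflect e x)
    have : σ⁻¹ * (√P.b)⁻¹ ≤ s⁻¹ * (√P.b)⁻¹ := by gcongr
    linarith
  have hR2 : σ⁻¹ * (√P.b)⁻¹ + ‖P.reflect e x‖ ≤ R := by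
    have := norm_nonneg x
    have : σ⁻¹ * (√P.b)⁻¹ ≤ s⁻¹ * (√P.b)⁻¹ := by gcongr
    linarith
  have hsub : ∀ f g : E → ℝ, Function.support f ⊆ closedBall 0 (σ⁻¹ * (√P.b)⁻¹ + ‖x‖) →
      Function.support g ⊆ closedBall 0 (σ⁻¹ * (√P.b)⁻¹ + ‖P.reflect e x‖) →
      Function.support (fun y => f y - g y) ⊆ closedBall 0 R := fun f g hf hg =>
    (Function.support_sub f g).trans (union_subset
      (hf.trans (closedBall_subset_closedBall hR1)) (hg.trans (closedBall_subset_closedBall hR2)))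
  have hd : ∀ z, ContDiff ℝ 1 (P.bump 4 σ z) := fun z => P.contDiff_bump 2 σ z
  have hgrad : ∀ y, gradient (fun y => P.bump 4 σ x y - P.bump 4 σ (P.reflect e x) y) y =
      gradient (P.bump 4 σ x) y + -gradient (P.bump 4 σ (P.reflect e x)) y := by
    intro y
    rw [gradient, fderiv_fun_sub ((hd _).differentiable one_ne_zero y)
      ((hd _).differentiable one_ne_zero y), map_sub, sub_eq_add_neg]
    rfl
  have hdb : ∀ y, P.divBump (Module.finrank ℝ E) σ x y -
        P.divBump (Module.finrank ℝ E) σ (P.reflect e x) y = P.divBump (Module.finrank ℝ E) σ x y +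
        -P.divBump (Module.finrank ℝ E) σ (P.reflect e x) y := fun y => sub_eq_add_neg _ _
  have hInt : ∀ z, Integrable (fun y => P.A (gradient (P.bump 4 σ z) y)) μ := fun z =>
    (P.A.continuous.comp (continuous_gradient (hd z))).integrable_of_hasCompactSupport
      ((hasCompactSupport_gradient (P.hasCompactSupport_bump (by simp) hσ0 z)).comp_left
        (map_zero _))
  have hcs : ∀ z, HasCompactSupport (P.divBump (Module.finrank ℝ E) σ z) := fun z =>
    HasCompactSupport.of_support_subset_isCompact (isCompact_closedBall _ _)
      (P.support_divBump_subset _ hσ0 z)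
  refine ⟨(hd _).sub (hd _), hsub _ _ (P.support_bump_subset (by simp) hσ0 _)
    (P.support_bump_subset (by simp) hσ0 _), fun y hy => ?_, fun y => ?_,
    fun y => ?_, by fun_prop, hsub _ _ (P.support_divBump_subset _ hσ0 _)
    (P.support_divBump_subset _ hσ0 _), fun y => ?_, ?_⟩
  · refine sub_nonneg.2 (cutPow_anti 4 (mul_le_mul_of_nonneg_left ?_ (sq_nonneg _)))
    rw [P.q_sub_reflect he]
    have : 0 ≤ 4 * ⟪e, x⟫ * ⟪e, y⟫ / P.q (P.A e) := by positivity
    linarith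
  · have h1 := P.bump_le_one 4 σ x y
    have h2 := P.bump_nonneg 4 σ (P.reflect e x) y
    exact (by linarith : _ ≤ (1 : ℝ)).trans ((le_max_left _ _).trans hS)
  · rw [hgrad]
    refine le_trans ?_ (((le_max_left _ _).trans (le_max_right _ _)).trans hS)
    refine (norm_add_le _ _).trans ?_
    rw [norm_neg]
    have h1 := P.norm_gradient_bump_le hσ0 x y
    have h2 := P.norm_gradient_bump_le hσ0 (P.reflect e x) y
    have h3 : 8 * σ * ‖P.B‖ * (√P.b)⁻¹ ≤ 8 * T * ‖P.B‖ * (√P.b)⁻¹ := by gcongr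
    linarith
  · refine le_trans ?_ (((le_max_right _ _).trans (le_max_right _ _)).trans hS)
    have hn : (0 : ℝ) ≤ Module.finrank ℝ E := Nat.cast_nonneg _
    have h1 := P.abs_divBump_le hn σ x y
    have h2 := P.abs_divBump_le hn σ (P.reflect e x) y
    have h3 : 8 * σ ^ 2 * ((Module.finrank ℝ E : ℝ) + 6) ≤
        8 * T ^ 2 * ((Module.finrank ℝ E : ℝ) + 6) := by gcongr
    have := abs_sub (P.divBump (Module.finrank ℝ E) σ x y)
      (P.divBump (Module.finrank ℝ E) σ (P.reflect e x) y)
    linarith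
  · simp only [hgrad, hdb, map_add, map_neg]
    exact (P.isWeakDiv_bump hσ0 x).add (P.isWeakDiv_bump hσ0 (P.reflect e x)).neg (hInt _)
      (hInt _).neg (by fun_prop) (by fun_prop) (hcs _) (hcs _).neg

end FrozenCoeff

namespace FrozenCoeff

variable {E : Type*} [NormedAddCommGroup E] [InnerProductSpace ℝ E] (P : FrozenCoeff E)
  [MeasurableSpace E]

/-- The total integral of the standard truncated power. -/
def mass (μ : Measure E) : ℝ := ∫ y, P.bump 3 1 0 y ∂μ

variable [FiniteDimensional ℝ E] [BorelSpace E] {μ : Measure E} [μ.IsAddHaarMeasure]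

lemma mass_pos : 0 < P.mass μ := by
  refine (P.continuous_bump 3 1 0).integral_pos_of_hasCompactSupport_nonneg_nonzero
    (P.hasCompactSupport_bump (by simp) one_pos 0) (fun y => P.bump_nonneg _ _ _ _) (x := 0) ?_
  simp [bump, q, cutPow]

lemma integral_mul_pow_mul_bump (g : E → ℝ) (k : ℕ) {σ : ℝ} (hσ : 0 < σ) (x : E) :
    ∫ y, g y * (σ ^ Module.finrank ℝ E * P.bump k σ x y) ∂μ =
      ∫ z, g (σ⁻¹ • z) * P.bump k 1 (σ • x) z ∂μ := by
  have h := Measure.integral_comp_smul_of_nonneg μ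
    (fun z => g (σ⁻¹ • z) * P.bump k 1 (σ • x) z) σ (hR := hσ.le)
  have h' : ∫ z, g (σ⁻¹ • z) * P.bump k 1 (σ • x) z ∂μ = σ ^ Module.finrank ℝ E *
      ∫ y, g (σ⁻¹ • σ • y) * P.bump k 1 (σ • x) (σ • y) ∂μ := by
    rw [h, smul_eq_mul, mul_inv_cancel_left₀ (by positivity)]
  rw [h', ← integral_const_mul]
  refine integral_congr_ae (ae_of_all _ fun y => ?_)
  simp only [smul_smul, inv_mul_cancel₀ hσ.ne', one_smul, bump, ← smul_sub, P.q_smul, one_pow,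
    one_mul]
  ring

lemma integral_pow_mul_bump {σ : ℝ} (hσ : 0 < σ) (x : E) :
    ∫ y, σ ^ Module.finrank ℝ E * P.bump 3 σ x y ∂μ = P.mass μ := by
  have h := P.integral_mul_pow_mul_bump (μ := μ) (fun _ => 1) 3 hσ x
  simp only [one_mul] at h
  rw [h, mass, ← integral_sub_right_eq_self (fun y => P.bump 3 1 0 y) (σ • x)]
  simp [bump]

lemma abs_integral_bump_sub_le {w : E → ℝ} {L : ℝ≥0} (hw : LipschitzWith L w) {σ : ℝ}
    (hσ : 0 < σ) (x : E) :
    |∫ y, w y * (σ ^ Module.finrank ℝ E * P.bump 3 σ x y) ∂μ - P.mass μ * w x| ≤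
      L * (σ⁻¹ * (√P.b)⁻¹) * P.mass μ := by
  have i1 : ∀ g : E → ℝ, Continuous g →
      Integrable (fun y => g y * (σ ^ Module.finrank ℝ E * P.bump 3 σ x y)) μ := by
    intro g hg
    have := P.integrable_mul_bump (μ := μ) (hg.mul_const (σ ^ Module.finrank ℝ E)) (k := 3)
      (by simp) hσ x
    simpa only [mul_assoc] using this
  have h1 : ∫ y, w y * (σ ^ Module.finrank ℝ E * P.bump 3 σ x y) ∂μ - P.mass μ * w x =
      ∫ y, (w y - w x) * (σ ^ Module.finrank ℝ E * P.bump 3 σ x y) ∂μ := by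
    simp only [sub_mul]
    rw [integral_sub (i1 w hw.continuous) (i1 _ continuous_const), integral_const_mul,
      P.integral_pow_mul_bump hσ, mul_comm (w x)]
  rw [h1, ← P.integral_pow_mul_bump (μ := μ) hσ x, ← integral_const_mul, ← Real.norm_eq_abs]
  refine norm_integral_le_of_norm_le (i1 (fun _ => L * (σ⁻¹ * (√P.b)⁻¹)) continuous_const)
    (ae_of_all _ fun y => ?_)
  have h2 : 0 ≤ σ ^ Module.finrank ℝ E * P.bump 3 σ x y :=
    mul_nonneg (by positivity) (P.bump_nonneg _ _ _ _)
  rw [Real.norm_eq_abs, abs_mul, abs_of_nonneg h2]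
  by_cases h : P.bump 3 σ x y = 0
  · simp [h]
  · refine mul_le_mul_of_nonneg_right ?_ h2
    refine (hw.dist_le_mul y x).trans ?_
    rw [dist_eq_norm]
    gcongr
    exact (P.norm_sub_lt_of_bump_ne_zero (by simp) hσ h).le

end FrozenCoeff

namespace IsExteriorSubsol

variable {E : Type*} [NormedAddCommGroup E] [InnerProductSpace ℝ E]
    [FiniteDimensional ℝ E] [MeasurableSpace E] {μ : Measure E} {P : FrozenCoeff E} {e : E}
    {a : E → E →L[ℝ] E} {L : ℝ≥0} {ρ K γ M : ℝ} {v : E → ℝ}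

lemma eventually_rescale_eq_zero (h : IsExteriorSubsol μ P e a L ρ K γ M v) {x : E}
    (hx : ⟪e, x⟫ < 0) : ∀ᶠ r in 𝓝[>] (0 : ℝ), rescale v r x = 0 := by
  have t1 : Tendsto (fun r : ℝ => r * ‖x‖) (𝓝[>] 0) (𝓝 0) := by
    have : Tendsto (fun r : ℝ => r * ‖x‖) (𝓝 0) (𝓝 (0 * ‖x‖)) := tendsto_id.mul_const _
    rw [zero_mul] at this
    exact this.mono_left nhdsWithin_le_nhds
  have t2 : Tendsto (fun r : ℝ => r * ‖x‖ ^ 2 + 2 * ρ * ⟪e, x⟫) (𝓝[>] 0)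
      (𝓝 (2 * ρ * ⟪e, x⟫)) := by
    have : Tendsto (fun r : ℝ => r * ‖x‖ ^ 2 + 2 * ρ * ⟪e, x⟫) (𝓝 0)
        (𝓝 (0 * ‖x‖ ^ 2 + 2 * ρ * ⟪e, x⟫)) := (tendsto_id.mul_const _).add_const _
    rw [zero_mul, zero_add] at this
    exact this.mono_left nhdsWithin_le_nhds
  have hneg : 2 * ρ * ⟪e, x⟫ < 0 := mul_neg_of_pos_of_neg (by have := h.rho_pos; positivity) hx
  filter_upwards [t1.eventually_lt_const one_pos, t2.eventually_lt_const hneg,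
    self_mem_nhdsWithin] with r h1 h2 hr
  exact h.rescale_eq_zero hr h1 h2

lemma e_ne_zero (h : IsExteriorSubsol μ P e a L ρ K γ M v) : e ≠ 0 := by
  rintro rfl
  simpa using h.norm_e

/-- The difference of the averages of the blow-up at scale `r` around a point and its
reflection. -/
def reflectedAverage (μ : Measure E) (P : FrozenCoeff E) (e x : E) (v : E → ℝ) (r σ : ℝ) : ℝ :=
  ∫ y, rescale v r y * (σ ^ Module.finrank ℝ E * P.bump 3 σ x y) ∂μ -
    ∫ y, rescale v r y * (σ ^ Module.finrank ℝ E * P.bump 3 σ (P.reflect e x) y) ∂μ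

variable [BorelSpace E] [μ.IsAddHaarMeasure]

lemma hasDerivAt_reflectedAverage (h : IsExteriorSubsol μ P e a L ρ K γ M v) (x : E) {r σ : ℝ}
    (hr : 0 < r) (hσ : 0 < σ) :
    HasDerivAt (reflectedAverage μ P e x v r) (-(8⁻¹ * (σ ^ Module.finrank ℝ E / σ ^ 3)) *
      ∫ y, rescale v r y * (P.divBump (Module.finrank ℝ E) σ x y -
        P.divBump (Module.finrank ℝ E) σ (P.reflect e x) y) ∂μ) σ := by
  have hw := (h.lipschitz.rescale hr.ne').continuous
  have hpow : ((Module.finrank ℝ E : ℕ) : ℝ) * σ ^ (Module.finrank ℝ E - 1) =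
      Module.finrank ℝ E * (σ ^ Module.finrank ℝ E / σ) := by
    rcases Nat.eq_zero_or_pos (Module.finrank ℝ E) with h0 | h0
    · simp [h0]
    · rw [← pow_sub_one_mul h0.ne' σ, mul_div_cancel_right₀ _ hσ.ne']
  have h1 : ∀ z, HasDerivAt
      (fun σ => ∫ y, rescale v r y * (σ ^ Module.finrank ℝ E * P.bump 3 σ z y) ∂μ)
      (-(8⁻¹ * (σ ^ Module.finrank ℝ E / σ ^ 3)) *
        ∫ y, rescale v r y * P.divBump (Module.finrank ℝ E) σ z y ∂μ) σ := by
    intro z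
    refine (P.hasDerivAt_integral_bump (μ := μ) hw (Module.finrank ℝ E) 1 z hσ).congr_deriv ?_
    rw [← integral_const_mul]
    refine integral_congr_ae (ae_of_all _ fun y => ?_)
    simp only [FrozenCoeff.divBump, hpow]
    push_cast
    field_simp
    ring
  have h2 : ∀ z, Integrable (fun y => rescale v r y * P.divBump (Module.finrank ℝ E) σ z y) μ :=
    fun z => (hw.mul (P.continuous_divBump _ σ z)).integrable_of_hasCompactSupport
      (HasCompactSupport.of_support_subset_isCompact (isCompact_closedBall _ _)
        (P.support_divBump_subset _ hσ z)).mul_left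
  refine ((h1 x).sub (h1 (P.reflect e x))).congr_deriv ?_
  simp only [mul_sub]
  rw [integral_sub (h2 _) (h2 _)]
  ring

lemma eventually_reflectedAverage_le (h : IsExteriorSubsol μ P e a L ρ K γ M v) {x : E}
    (hx : 0 ≤ ⟪e, x⟫) {s T : ℝ} (hs : 0 < s) (hsT : s ≤ T) {ε : ℝ} (hε : 0 < ε) :
    ∀ᶠ r in 𝓝[>] (0 : ℝ), reflectedAverage μ P e x v r T ≤ reflectedAverage μ P e x v r s + ε := by
  obtain ⟨R, hR, S, hS⟩ := P.exists_isHalfPotential_reflect (μ := μ) h.e_ne_zero hx hs T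
  obtain ⟨C, hC, hev⟩ := h.exists_le_integral_rescale hR
  set D := 8⁻¹ * (T ^ Module.finrank ℝ E / s ^ 3) * (C * S) with hD
  have hT : 0 < T := hs.trans_le hsT
  have hlim : Tendsto (fun r : ℝ => D * r ^ γ * (T - s)) (𝓝[>] 0) (𝓝 0) := by
    have := ((Real.continuousAt_rpow_const 0 γ (Or.inr h.gamma_pos.le)).tendsto.const_mul
      D).mul_const (T - s)
    rw [Real.zero_rpow h.gamma_pos.ne', mul_zero, zero_mul] at this
    exact this.mono_left nhdsWithin_le_nhds
  filter_upwards [hev, hlim.eventually_lt_const hε, self_mem_nhdsWithin] with r h1 h2 hr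
  have hr : 0 < r := hr
  have hder : ∀ σ ∈ Icc s T, HasDerivAt (reflectedAverage μ P e x v r) _ σ := fun σ hσ =>
    h.hasDerivAt_reflectedAverage x hr (hs.trans_le hσ.1)
  have key := (convex_Icc s T).image_sub_le_mul_sub_of_deriv_le
    (f := reflectedAverage μ P e x v r) (C := D * r ^ γ)
    (fun σ hσ => (hder σ hσ).continuousAt.continuousWithinAt)
    (fun σ hσ => (hder σ (interior_subset hσ)).differentiableAt.differentiableWithinAt) ?_
    s (left_mem_Icc.2 hsT) T (right_mem_Icc.2 hsT) hsT
  · linarith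
  · intro σ hσ
    replace hσ := interior_subset hσ
    have hσ0 := hs.trans_le hσ.1
    have hrγ := Real.rpow_nonneg hr.le γ
    rw [(hder σ hσ).deriv, neg_mul, ← mul_neg]
    have h3 := h1 S _ _ (hS σ hσ)
    calc _ ≤ 8⁻¹ * (σ ^ Module.finrank ℝ E / σ ^ 3) * (C * S * r ^ γ) :=
          mul_le_mul_of_nonneg_left (by linarith) (by positivity)
      _ ≤ 8⁻¹ * (T ^ Module.finrank ℝ E / s ^ 3) * (C * S * r ^ γ) := by
          have := hσ.1; have := hσ.2
          gcongr
      _ = _ := by rw [hD]; ring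

end IsExteriorSubsol

namespace FrozenCoeff

variable {E : Type*} [NormedAddCommGroup E] [InnerProductSpace ℝ E] (P : FrozenCoeff E)

lemma bump_sub_bump_reflect_le {e : E} (he : e ≠ 0) (x y : E) :
    P.bump 3 1 x y - P.bump 3 1 (P.reflect e x) y ≤
      12 * ⟪e, x⟫ / P.q (P.A e) * (⟪e, y⟫ * P.bump 2 1 x y) := by
  refine (cutPow_three_sub_le _ _).trans (le_of_eq ?_)
  rw [P.q_sub_reflect he, bump]
  ring

lemma abs_bump_smul_sub_le {R : ℝ} (x : E) {y : E} (hy : ‖y‖ ≤ R) {s : ℝ} (hs : 0 ≤ s)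
    (hs1 : s ≤ 1) :
    |P.bump 2 1 (s • x) y - P.bump 2 1 0 y| ≤ 2 * (2 * ‖P.B‖ * R * ‖x‖ + P.q x) * s := by
  refine (abs_cutPow_two_sub_le _ _ (P.sq_mul_q_nonneg _ _) (P.sq_mul_q_nonneg _ _)).trans ?_
  rw [mul_assoc]
  refine mul_le_mul_of_nonneg_left ?_ two_pos.le
  have h1 : (1 : ℝ) ^ 2 * P.q (y - s • x) - 1 ^ 2 * P.q (y - 0) =
      s * (s * P.q x - 2 * ⟪P.B y, x⟫) := by
    rw [sub_eq_add_neg y (s • x), P.q_add, P.q_neg, P.q_smul, inner_neg_right, inner_smul_right,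
      sub_zero]
    ring
  rw [h1, abs_mul, abs_of_nonneg hs, mul_comm]
  refine mul_le_mul_of_nonneg_right ?_ hs
  have h2 : |⟪P.B y, x⟫| ≤ ‖P.B‖ * R * ‖x‖ :=
    (abs_real_inner_le_norm _ _).trans (by gcongr; exact (P.B.le_opNorm y).trans (by gcongr))
  have h3 : s * P.q x ≤ P.q x := mul_le_of_le_one_left (P.q_nonneg x) hs1
  have h4 : 0 ≤ s * P.q x := mul_nonneg hs (P.q_nonneg x)
  have h5 := abs_le.1 h2
  rw [abs_le]
  constructor <;> linarith [h5.1, h5.2]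

lemma integrable_mul_inner_mul_bump [FiniteDimensional ℝ E] [MeasurableSpace E] [BorelSpace E]
    {μ : Measure E} [IsFiniteMeasureOnCompacts μ] {w : E → ℝ} (hw : Continuous w) (e x : E) :
    Integrable (fun y => w y * (⟪e, y⟫ * P.bump 2 1 x y)) μ :=
  Continuous.integrable_of_hasCompactSupport (by fun_prop)
    (HasCompactSupport.mul_left (P.hasCompactSupport_bump (by simp) one_pos x).mul_left)

end FrozenCoeff

namespace IsExteriorSubsol

variable {E : Type*} [NormedAddCommGroup E] [InnerProductSpace ℝ E]
    [FiniteDimensional ℝ E] [MeasurableSpace E] [BorelSpace E] {μ : Measure E}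
    [μ.IsAddHaarMeasure] {P : FrozenCoeff E} {e : E}
    {a : E → E →L[ℝ] E} {L : ℝ≥0} {ρ K γ M : ℝ} {v : E → ℝ}

lemma reflectedAverage_le_integral (h : IsExteriorSubsol μ P e a L ρ K γ M v) (x : E) {r s : ℝ}
    (hr : 0 < r) (hs : 0 < s) :
    reflectedAverage μ P e x v r s ≤ 12 * ⟪e, x⟫ / P.q (P.A e) *
      ∫ z, rescale v (r / s) z * (⟪e, z⟫ * P.bump 2 1 (s • x) z) ∂μ := by
  have hrs : 0 < r / s := div_pos hr hs
  have hw := (h.lipschitz.rescale hrs.ne').continuous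
  have hInt : ∀ z, Integrable (fun y => rescale v (r / s) y * P.bump 3 1 z y) μ := fun z =>
    P.integrable_mul_bump hw (by simp) one_pos z
  have h1 : ∀ z, rescale v r (s⁻¹ • z) = s⁻¹ * rescale v (r / s) z := fun z => by
    rw [rescale_mul v r (inv_ne_zero hs.ne'), div_eq_mul_inv]
  have h2 : reflectedAverage μ P e x v r s = s⁻¹ * ∫ z, rescale v (r / s) z *
      (P.bump 3 1 (s • x) z - P.bump 3 1 (P.reflect e (s • x)) z) ∂μ := by
    rw [reflectedAverage, P.integral_mul_pow_mul_bump _ 3 hs, P.integral_mul_pow_mul_bump _ 3 hs]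
    simp only [h1, mul_sub, mul_assoc, P.reflect_smul]
    rw [integral_sub (hInt _) (hInt _), integral_const_mul, integral_const_mul, mul_sub]
  have h3 : ∫ z, rescale v (r / s) z *
      (P.bump 3 1 (s • x) z - P.bump 3 1 (P.reflect e (s • x)) z) ∂μ ≤
      ∫ z, 12 * ⟪e, s • x⟫ / P.q (P.A e) *
        (rescale v (r / s) z * (⟪e, z⟫ * P.bump 2 1 (s • x) z)) ∂μ := by
    refine integral_mono ?_ ?_ fun z => ?_
    · simp only [mul_sub]
      exact (hInt _).sub (hInt _)
    · exact (P.integrable_mul_inner_mul_bump hw e _).const_mul _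
    · have := mul_le_mul_of_nonneg_left (P.bump_sub_bump_reflect_le h.e_ne_zero (s • x) z)
        (h.rescale_nonneg hrs z)
      linarith
  rw [h2]
  refine (mul_le_mul_of_nonneg_left h3 (inv_pos.2 hs).le).trans (le_of_eq ?_)
  rw [integral_const_mul, inner_smul_right]
  field_simp

lemma exists_integral_le_moment (h : IsExteriorSubsol μ P e a L ρ K γ M v) (x : E) :
    ∃ C, 0 ≤ C ∧ ∀ r, 0 < r → ∀ s, 0 ≤ s → s ≤ 1 →
      ∫ z, rescale v r z * (⟪e, z⟫ * P.bump 2 1 (s • x) z) ∂μ ≤ moment μ P e v r + C * s := by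
  have hb := inv_pos.2 (Real.sqrt_pos.2 P.b_pos)
  set R := (√P.b)⁻¹ + ‖x‖ with hR
  have hRnn : 0 ≤ R := by positivity
  have hq := P.q_nonneg x
  refine ⟨L * R * (R * (2 * (2 * ‖P.B‖ * R * ‖x‖ + P.q x))) * μ.real (closedBall 0 R),
    by positivity, fun r hr s hs hs1 => ?_⟩
  have hw := (h.lipschitz.rescale hr.ne').continuous
  have hsupp : ∀ t : ℝ, 0 ≤ t → t ≤ 1 → ∀ y ∉ closedBall (0 : E) R, P.bump 2 1 (t • x) y = 0 := by
    intro t ht ht1 y hy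
    by_contra hne
    refine hy (closedBall_subset_closedBall ?_ (P.support_bump_subset (by simp) one_pos _ hne))
    rw [inv_one, one_mul, norm_smul, Real.norm_eq_abs, abs_of_nonneg ht]
    have := mul_le_of_le_one_left (norm_nonneg x) ht1
    linarith
  have h1 : |∫ y, rescale v r y * (⟪e, y⟫ * (P.bump 2 1 (s • x) y - P.bump 2 1 0 y)) ∂μ| ≤
      L * R * (R * (2 * (2 * ‖P.B‖ * R * ‖x‖ + P.q x) * s)) * μ.real (closedBall 0 R) := by
    refine abs_integral_le_of_closedBall (fun y hy => ?_) fun y hy => ?_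
    · rw [mem_closedBall_zero_iff] at hy
      rw [abs_mul, abs_mul, abs_of_nonneg (h.rescale_nonneg hr y)]
      have e1 : rescale v r y ≤ L * R := (h.rescale_le hr y).trans (by gcongr)
      have e2 : |⟪e, y⟫| ≤ R := by
        refine (abs_real_inner_le_norm _ _).trans ?_
        rwa [h.norm_e, one_mul]
      have e3 := P.abs_bump_smul_sub_le x hy hs hs1
      exact mul_le_mul e1 (mul_le_mul e2 e3 (abs_nonneg _) hRnn)
        (by positivity) (by positivity)
    · have := hsupp 0 le_rfl zero_le_one y hy
      rw [zero_smul] at this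
      rw [hsupp s hs hs1 y hy, this]
      simp
  simp only [mul_sub] at h1
  rw [integral_sub (P.integrable_mul_inner_mul_bump hw e _)
    (P.integrable_mul_inner_mul_bump hw e _)] at h1
  have := (abs_le.1 h1).2
  rw [moment]
  linarith

lemma eventually_rescale_le (h : IsExteriorSubsol μ P e a L ρ K γ M v) {N : ℝ}
    (hN : Tendsto (moment μ P e v) (𝓝[>] 0) (𝓝 N)) {x : E} (hx : 0 < ⟪e, x⟫) {ε : ℝ}
    (hε : 0 < ε) :
    ∀ᶠ r in 𝓝[>] (0 : ℝ),
      P.mass μ * rescale v r x ≤ 12 * ⟪e, x⟫ / P.q (P.A e) * N + ε := by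
  have hb := inv_pos.2 (Real.sqrt_pos.2 P.b_pos)
  have hm := P.mass_pos (μ := μ)
  have hc := P.q_A_pos h.e_ne_zero
  obtain ⟨C, hC, hmom⟩ := h.exists_integral_le_moment x
  set β := 12 * ⟪e, x⟫ / P.q (P.A e) with hβ
  have hβ0 : 0 < β := by positivity
  obtain ⟨s, hs, hs1, hsC⟩ : ∃ s : ℝ, 0 < s ∧ s ≤ 1 ∧ β * (C * s) ≤ ε / 4 := by
    refine ⟨min 1 (ε / 4 / (β * C + 1)), by positivity, min_le_left _ _, ?_⟩
    have h1 : β * (C * min 1 (ε / 4 / (β * C + 1))) ≤ (β * C + 1) * (ε / 4 / (β * C + 1)) := by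
      rw [← mul_assoc]
      exact mul_le_mul (by linarith) (min_le_right _ _) (by positivity) (by positivity)
    refine h1.trans (le_of_eq ?_)
    field_simp
  set Q := 2 * L * (√P.b)⁻¹ * P.mass μ with hQ
  have hQ0 : 0 ≤ Q := by positivity
  obtain ⟨T, hT, hQT⟩ : ∃ T : ℝ, s ≤ T ∧ Q * T⁻¹ ≤ ε / 4 := by
    refine ⟨max s (Q / (ε / 4)), le_max_left _ _, ?_⟩
    have hpos : 0 < max s (Q / (ε / 4)) := lt_max_of_lt_left hs
    rw [mul_inv_le_iff₀ hpos]
    have := le_max_right s (Q / (ε / 4))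
    rw [div_le_iff₀ (by positivity)] at this
    linarith
  have hT0 := hs.trans_le hT
  have hlim : Tendsto (fun r => β * moment μ P e v (r / s)) (𝓝[>] 0) (𝓝 (β * N)) := by
    refine (hN.comp ?_).const_mul β
    refine tendsto_nhdsWithin_iff.2 ⟨?_, ?_⟩
    · have : Tendsto (fun r : ℝ => r / s) (𝓝 0) (𝓝 (0 / s)) := tendsto_id.div_const s
      rw [zero_div] at this
      exact this.mono_left nhdsWithin_le_nhds
    · filter_upwards [self_mem_nhdsWithin] with r hr
      exact div_pos hr hs
  have hrefl : ⟪e, P.reflect e x⟫ < 0 := by rw [P.inner_reflect h.e_ne_zero]; linarith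
  filter_upwards [h.eventually_reflectedAverage_le hx.le hs hT (show 0 < ε / 4 by positivity),
    h.eventually_rescale_eq_zero hrefl,
    hlim.eventually_lt_const (show β * N < β * N + ε / 4 by linarith), self_mem_nhdsWithin]
    with r h1 h2 h3 hr
  have hr : 0 < r := hr
  have a1 := P.abs_integral_bump_sub_le (μ := μ) (h.lipschitz.rescale hr.ne') hT0 x
  have a2 := P.abs_integral_bump_sub_le (μ := μ) (h.lipschitz.rescale hr.ne') hT0 (P.reflect e x)
  rw [h2, mul_zero, sub_zero] at a2
  have a3 := h.reflectedAverage_le_integral x hr hs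
  have a4 := mul_le_mul_of_nonneg_left (hmom (r / s) (div_pos hr hs) s hs.le hs1) hβ0.le
  have a5 : L * (T⁻¹ * (√P.b)⁻¹) * P.mass μ + L * (T⁻¹ * (√P.b)⁻¹) * P.mass μ = Q * T⁻¹ := by
    rw [hQ]; ring
  have b1 := (abs_le.1 a1).1
  have b2 := (abs_le.1 a2).2
  rw [reflectedAverage] at h1
  linarith

end IsExteriorSubsol

namespace FrozenCoeff

variable {E : Type*} [NormedAddCommGroup E] [InnerProductSpace ℝ E] (P : FrozenCoeff E)
  [MeasurableSpace E] [FiniteDimensional ℝ E] [BorelSpace E] {μ : Measure E} [μ.IsAddHaarMeasure]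

lemma integral_sq_inner_mul_bump (e : E) :
    ∫ y, ⟪e, y⟫ * (⟪e, y⟫ * P.bump 2 1 0 y) ∂μ = P.q (P.A e) * P.mass μ / 6 := by
  have h := isWeakDiv_smul_const (μ := μ) (P.contDiff_bump 1 1 0)
    (P.hasCompactSupport_bump (by simp) one_pos 0) (P.A e) (fun y => ⟪e, y⟫) ‖innerSL ℝ e‖₊
    (innerSL ℝ e).lipschitz
  have h1 : ∀ y, gradient (fun y => ⟪e, y⟫) y = e := fun y =>
    ext_inner_right ℝ fun z => by rw [inner_gradient_left, (hasFDerivAt_inner_left e y).fderiv]; rfl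
  have h2 : ∀ y, ⟪gradient (P.bump (1 + 2) 1 0) y, P.A e⟫ = -6 * (⟪e, y⟫ * P.bump 2 1 0 y) := by
    intro y
    rw [P.gradient_bump 1, inner_smul_left, ← P.symm_A, P.A_B, real_inner_comm]
    simp
    ring
  have h3 : ∀ y : E, ⟪e, y⟫ * (-6 * (⟪e, y⟫ * P.bump 2 1 0 y)) =
      -6 * (⟪e, y⟫ * (⟪e, y⟫ * P.bump 2 1 0 y)) := fun y => by ring
  simp only [h1, h2, h3, inner_smul_right, ← P.q_A] at h
  rw [integral_mul_const, integral_const_mul, ← mass] at h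
  linarith

lemma integral_max_inner_mul_bump (e : E) :
    ∫ y, max ⟪e, y⟫ 0 * (⟪e, y⟫ * P.bump 2 1 0 y) ∂μ = P.q (P.A e) * P.mass μ / 12 := by
  have hodd : ∫ y, |⟪e, y⟫| * (⟪e, y⟫ * P.bump 2 1 0 y) ∂μ = 0 := by
    have h := integral_neg_eq_self (fun y => |⟪e, y⟫| * (⟪e, y⟫ * P.bump 2 1 0 y)) μ
    have h1 : ∀ y, |⟪e, -y⟫| * (⟪e, -y⟫ * P.bump 2 1 0 (-y)) =
        -(|⟪e, y⟫| * (⟪e, y⟫ * P.bump 2 1 0 y)) := by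
      intro y
      simp [bump, P.q_neg]
    simp only [h1, integral_neg] at h
    linarith
  have hc : Continuous fun y : E => ⟪e, y⟫ := continuous_const.inner continuous_id
  have i1 := P.integrable_mul_inner_mul_bump (μ := μ) hc e 0
  have i2 := P.integrable_mul_inner_mul_bump (μ := μ) hc.abs e 0
  have h2 : ∀ y : E, max ⟪e, y⟫ 0 * (⟪e, y⟫ * P.bump 2 1 0 y) = 2⁻¹ *
      (⟪e, y⟫ * (⟪e, y⟫ * P.bump 2 1 0 y) + |⟪e, y⟫| * (⟪e, y⟫ * P.bump 2 1 0 y)) := by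
    intro y
    rcases le_total 0 ⟪e, y⟫ with h | h
    · rw [max_eq_left h, abs_of_nonneg h]; ring
    · rw [max_eq_right h, abs_of_nonpos h]; ring
  simp only [h2]
  rw [integral_const_mul, integral_add i1 i2, hodd, P.integral_sq_inner_mul_bump]
  ring

end FrozenCoeff

namespace IsExteriorSubsol

variable {E : Type*} [NormedAddCommGroup E] [InnerProductSpace ℝ E]
    [FiniteDimensional ℝ E] [MeasurableSpace E] [BorelSpace E] {μ : Measure E}
    [μ.IsAddHaarMeasure] {P : FrozenCoeff E} {e : E}
    {a : E → E →L[ℝ] E} {L : ℝ≥0} {ρ K γ M : ℝ} {v : E → ℝ}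

lemma exists_eventually_rescale_le (h : IsExteriorSubsol μ P e a L ρ K γ M v) :
    ∃ α ≥ 0, Tendsto (moment μ P e v) (𝓝[>] 0) (𝓝 (α * (P.q (P.A e) * P.mass μ / 12))) ∧
      ∀ x, ∀ ε > 0, ∀ᶠ r in 𝓝[>] (0 : ℝ), rescale v r x ≤ α * max ⟪e, x⟫ 0 + ε := by
  obtain ⟨N, hN⟩ := h.exists_tendsto_moment
  have hm := P.mass_pos (μ := μ)
  have hc := P.q_A_pos h.e_ne_zero
  have hee : ⟪e, e⟫ = 1 := by rw [real_inner_self_eq_norm_sq, h.norm_e, one_pow]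
  have hN0 : 0 ≤ N := by
    have h1 : 0 ≤ 12 * ⟪e, e⟫ / P.q (P.A e) * N := by
      refine le_of_forall_pos_le_add fun ε hε => ?_
      obtain ⟨r, hr, hr0⟩ := ((h.eventually_rescale_le hN (x := e) (by rw [hee]; exact one_pos)
        hε).and self_mem_nhdsWithin).exists
      exact (mul_nonneg hm.le (h.rescale_nonneg hr0 e)).trans hr
    rw [hee] at h1
    exact nonneg_of_mul_nonneg_right h1 (by positivity)
  refine ⟨12 * N / (P.q (P.A e) * P.mass μ), by positivity, ?_, fun x ε hε => ?_⟩
  · convert hN using 2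
    field_simp
  rcases lt_or_ge 0 ⟪e, x⟫ with hx | hx
  · filter_upwards [h.eventually_rescale_le hN hx (mul_pos hm hε)] with r hr
    rw [max_eq_left hx.le, ← mul_le_mul_iff_right₀ hm]
    refine hr.trans (le_of_eq ?_)
    field_simp
  · set δ := ε / (L + 1) with hδ
    have hδ0 : 0 < δ := by positivity
    have h1 : ⟪e, x - δ • e⟫ < 0 := by
      rw [inner_sub_right, inner_smul_right, hee]; linarith
    filter_upwards [h.eventually_rescale_eq_zero h1, self_mem_nhdsWithin] with r hr hr0
    have hr0 : 0 < r := hr0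
    have h2 := (h.lipschitz.rescale hr0.ne').dist_le_mul x (x - δ • e)
    rw [Real.dist_eq, hr, sub_zero, dist_eq_norm, sub_sub_cancel, norm_smul, h.norm_e, mul_one,
      Real.norm_eq_abs, abs_of_pos hδ0] at h2
    rw [max_eq_right hx, mul_zero, zero_add]
    have h3 : (L + 1) * δ = ε := by rw [hδ]; field_simp
    linarith [le_abs_self (rescale v r x)]

lemma exists_tendsto_rescale (h : IsExteriorSubsol μ P e a L ρ K γ M v) :
    ∃ α ≥ 0, ∀ x, P.q x < 1 → ∀ ε > 0, ∀ᶠ r in 𝓝[>] (0 : ℝ),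
      |α * max ⟪e, x⟫ 0 - rescale v r x| < ε := by
  obtain ⟨α, hα, hmom, hup⟩ := h.exists_eventually_rescale_le
  refine ⟨α, hα, fun x hx ε hε => ?_⟩
  have hcont : Continuous fun y : E => ⟪e, y⟫ := continuous_const.inner continuous_id
  have hcp : Continuous fun y : E => α * max ⟪e, y⟫ 0 :=
    continuous_const.mul (hcont.max continuous_const)
  set g : ℝ → E → ℝ := fun r y => α * max ⟪e, y⟫ 0 - rescale v r y with hg
  have hgc : ∀ r, 0 < r → Continuous (g r) := fun r hr =>
    hcp.sub (h.lipschitz.rescale hr.ne').continuous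
  have hInt' : ∀ w : E → ℝ, Continuous w → Integrable (fun y => w y * P.bump 2 1 0 y) μ :=
    fun w hw => P.integrable_mul_bump hw (by simp) one_pos 0
  have lim1 : Tendsto (fun r => ∫ y, g r y * (⟪e, y⟫ * P.bump 2 1 0 y) ∂μ) (𝓝[>] 0) (𝓝 0) := by
    have h1 := hmom.const_sub (α * (P.q (P.A e) * P.mass μ / 12))
    rw [sub_self] at h1
    refine h1.congr' ?_
    filter_upwards [self_mem_nhdsWithin] with r hr
    have hr : 0 < r := hr
    simp only [hg, sub_mul, mul_assoc]
    rw [integral_sub, integral_const_mul, P.integral_max_inner_mul_bump]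
    · rfl
    · exact (P.integrable_mul_inner_mul_bump (hcont.max continuous_const) e 0).const_mul α
    · exact P.integrable_mul_inner_mul_bump (h.lipschitz.rescale hr.ne').continuous e 0
  have lim2 : Tendsto (fun r => ∫ y, max (-g r y) 0 * max ⟪e, y⟫ 0 * P.bump 2 1 0 y ∂μ)
      (𝓝[>] 0) (𝓝 0) := by
    have hbnd : Integrable (fun y => L * ‖y‖ * max ⟪e, y⟫ 0 * P.bump 2 1 0 y) μ :=
      hInt' _ ((continuous_const.mul continuous_norm).mul (hcont.max continuous_const))
    have h2 := tendsto_integral_filter_of_dominated_convergence (μ := μ) (l := 𝓝[>] (0 : ℝ))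
      (F := fun r y => max (-g r y) 0 * max ⟪e, y⟫ 0 * P.bump 2 1 0 y) (f := fun _ => 0)
      _ ?_ ?_ hbnd ?_
    · simpa using h2
    · filter_upwards [self_mem_nhdsWithin] with r hr
      have := hgc r hr
      exact Continuous.aestronglyMeasurable (by fun_prop)
    · filter_upwards [self_mem_nhdsWithin] with r hr
      refine ae_of_all _ fun y => ?_
      have hbn := P.bump_nonneg 2 1 0 y
      have hm : 0 ≤ max ⟪e, y⟫ 0 := le_max_right _ _
      rw [Real.norm_of_nonneg (by positivity)]
      gcongr
      refine max_le ?_ (by positivity)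
      have := h.rescale_le hr y
      have := mul_nonneg hα hm
      simp only [hg]
      linarith
    · refine ae_of_all _ fun y => ?_
      have h3 : Tendsto (fun r => max (-g r y) 0) (𝓝[>] 0) (𝓝 0) := by
        rw [Metric.tendsto_nhds]
        intro η hη
        filter_upwards [hup y (η / 2) (by positivity)] with r hr
        rw [Real.dist_eq, sub_zero, abs_of_nonneg (le_max_right _ _)]
        refine max_lt ?_ hη
        simp only [hg]
        linarith
      simpa using (h3.mul_const (max ⟪e, y⟫ 0)).mul_const (P.bump 2 1 0 y)
  have lim3 : Tendsto (fun r => ∫ y, |g r y| * |⟪e, y⟫| * P.bump 2 1 0 y ∂μ) (𝓝[>] 0) (𝓝 0) := by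
    have h1 := lim1.add (lim2.const_mul 2)
    rw [mul_zero, zero_add] at h1
    refine h1.congr' ?_
    filter_upwards [self_mem_nhdsWithin] with r hr
    have := hgc r hr
    rw [← integral_const_mul, ← integral_add (P.integrable_mul_inner_mul_bump this e 0)
      ((hInt' (fun y => max (-g r y) 0 * max ⟪e, y⟫ 0) (by fun_prop)).const_mul 2)]
    refine integral_congr_ae (ae_of_all _ fun y => ?_)
    rcases le_total 0 ⟪e, y⟫ with h0 | h0
    · simp only [max_eq_left h0, abs_of_nonneg h0]
      rcases le_total 0 (g r y) with h1 | h1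
      · rw [abs_of_nonneg h1, max_eq_right (neg_nonpos.2 h1)]; ring
      · rw [abs_of_nonpos h1, max_eq_left (neg_nonneg.2 h1)]; ring
    · have h1 : g r y ≤ 0 := by
        simp only [hg, max_eq_right h0]
        linarith [h.rescale_nonneg hr y]
      simp only [max_eq_right h0, abs_of_nonpos h0, abs_of_nonpos h1]
      ring
  rcases le_or_gt ⟪e, x⟫ 0 with hx0 | hx0
  · filter_upwards [hup x (ε / 2) (by positivity), self_mem_nhdsWithin] with r hr hr0
    have := h.rescale_nonneg hr0 x
    rw [max_eq_right hx0] at hr ⊢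
    rw [abs_lt]
    constructor <;> linarith
  have hLip : ∀ r, 0 < r → ∀ y, |g r x| ≤ |g r y| + (α + L) * ‖y - x‖ := by
    intro r hr y
    have h1 := (h.lipschitz.rescale hr.ne').dist_le_mul x y
    rw [Real.dist_eq, dist_comm, dist_eq_norm] at h1
    have h2 : |max ⟪e, x⟫ 0 - max ⟪e, y⟫ 0| ≤ ‖y - x‖ := by
      refine (abs_max_sub_max_le_abs _ _ _).trans ?_
      rw [← inner_sub_right, norm_sub_rev]
      refine (abs_real_inner_le_norm _ _).trans (le_of_eq ?_)
      rw [h.norm_e, one_mul]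
    have h3 : g r x = g r y + (α * (max ⟪e, x⟫ 0 - max ⟪e, y⟫ 0) -
        (rescale v r x - rescale v r y)) := by simp only [hg]; ring
    have h4 := abs_sub (α * (max ⟪e, x⟫ 0 - max ⟪e, y⟫ 0)) (rescale v r x - rescale v r y)
    rw [abs_mul, abs_of_nonneg hα] at h4
    have h5 := mul_le_mul_of_nonneg_left h2 hα
    rw [h3]
    refine (abs_add_le _ _).trans ?_
    linarith
  set χ : E → ℝ := fun y => max (ε - (α + L) * ‖y - x‖) 0 * |⟪e, y⟫| * P.bump 2 1 0 y with hχ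
  have hχc : Continuous χ := by fun_prop
  have hpos : 0 < ∫ y, χ y ∂μ := by
    refine hχc.integral_pos_of_hasCompactSupport_nonneg_nonzero
      (P.hasCompactSupport_bump (by simp) one_pos 0).mul_left (fun y => ?_) (x := x) ?_
    · exact mul_nonneg (mul_nonneg (le_max_right _ _) (abs_nonneg _)) (P.bump_nonneg _ _ _ _)
    · have : 0 < P.bump 2 1 0 x := cutPow_pos 2 (by simpa using hx)
      have h2 : 0 < |⟪e, x⟫| := abs_pos.2 hx0.ne'
      simp only [hχ, sub_self, norm_zero, mul_zero, sub_zero, max_eq_left hε.le]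
      positivity
  filter_upwards [lim3.eventually_lt_const hpos, self_mem_nhdsWithin] with r hr hr0
  by_contra! hge
  refine hr.not_ge (integral_mono (hχc.integrable_of_hasCompactSupport
    (P.hasCompactSupport_bump (by simp) one_pos 0).mul_left) (hInt' _ ?_) fun y => ?_)
  · have := hgc r hr0
    fun_prop
  · have hbn := P.bump_nonneg 2 1 0 y
    simp only [hχ]
    gcongr
    refine max_le ?_ (abs_nonneg _)
    have := hLip r hr0 y
    change ε ≤ |g r x| at hge
    linarith

/-- A nonnegative Lipschitz subsolution vanishing in an exterior ball is asymptotic to a multiple of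
the positive part of the linear function at the contact point. -/
theorem exists_forall_eventually_le (h : IsExteriorSubsol μ P e a L ρ K γ M v) :
    ∃ α ≥ 0, ∀ ε > 0, ∀ᶠ x in 𝓝 (0 : E), |v x - α * max ⟪e, x⟫ 0| ≤ ε * ‖x‖ := by
  obtain ⟨α, hα, hlim⟩ := h.exists_tendsto_rescale
  refine ⟨α, hα, fun ε hε => ?_⟩
  obtain ⟨δ, hδ, hδq⟩ : ∃ δ > 0, ∀ y : E, ‖y‖ ≤ δ → P.q y < 1 := by
    have := P.continuous_q.tendsto 0
    rw [show P.q 0 = 0 by simp [FrozenCoeff.q]] at this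
    obtain ⟨δ, hδ, hs⟩ := Metric.eventually_nhds_iff.1 (this.eventually_lt_const one_pos)
    refine ⟨δ / 2, by positivity, fun y hy => hs ?_⟩
    rw [dist_zero_right]
    linarith
  set η := ε * δ / 2 with hη
  have hη0 : 0 < η := by positivity
  set β := η / (α + L + 1) with hβ
  have hβ0 : 0 < β := by positivity
  obtain ⟨t, hts, htf, hcov⟩ := (isCompact_closedBall (0 : E) δ).finite_cover_balls hβ0
  have hev : ∀ᶠ r in 𝓝[>] (0 : ℝ), ∀ y ∈ t, |α * max ⟪e, y⟫ 0 - rescale v r y| < η :=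
    htf.eventually_all.2 fun y hy =>
      hlim y (hδq y (mem_closedBall_zero_iff.1 (hts hy))) η hη0
  obtain ⟨r₀, hr₀, hsub⟩ := mem_nhdsGT_iff_exists_Ioo_subset.1 hev
  have hr₀ : 0 < r₀ := hr₀
  filter_upwards [ball_mem_nhds (0 : E) (mul_pos hδ hr₀)] with x hx
  rw [mem_ball_zero_iff] at hx
  rcases eq_or_ne x 0 with rfl | hx0
  · simp [h.map_zero]
  have hxn := norm_pos_iff.2 hx0
  set r := ‖x‖ / δ with hr
  have hr0 : 0 < r := by positivity
  have hrr : r < r₀ := by rw [hr, div_lt_iff₀ hδ]; linarith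
  set y := r⁻¹ • x with hy
  have hxy : x = r • y := by rw [hy, smul_smul, mul_inv_cancel₀ hr0.ne', one_smul]
  have hyn : ‖y‖ = δ := by
    rw [hy, norm_smul, Real.norm_eq_abs, abs_of_pos (inv_pos.2 hr0), hr]
    field_simp
  obtain ⟨z, hz, hyz⟩ := mem_iUnion₂.1 (hcov (mem_closedBall_zero_iff.2 hyn.le))
  have h1 := hsub ⟨hr0, hrr⟩ z hz
  have h2 := (h.lipschitz.rescale hr0.ne').dist_le_mul y z
  rw [mem_ball] at hyz
  have h3 : |max ⟪e, y⟫ 0 - max ⟪e, z⟫ 0| ≤ dist y z := by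
    refine (abs_max_sub_max_le_abs _ _ _).trans ?_
    rw [← inner_sub_right, dist_eq_norm]
    refine (abs_real_inner_le_norm _ _).trans (le_of_eq ?_)
    rw [h.norm_e, one_mul]
  have h4 : |rescale v r y - α * max ⟪e, y⟫ 0| ≤ 2 * η := by
    have e1 : rescale v r y - α * max ⟪e, y⟫ 0 = (rescale v r y - rescale v r z) -
        α * (max ⟪e, y⟫ 0 - max ⟪e, z⟫ 0) - (α * max ⟪e, z⟫ 0 - rescale v r z) := by ring
    have e2 := abs_sub ((rescale v r y - rescale v r z) -
        α * (max ⟪e, y⟫ 0 - max ⟪e, z⟫ 0)) (α * max ⟪e, z⟫ 0 - rescale v r z)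
    have e3 := abs_sub (rescale v r y - rescale v r z) (α * (max ⟪e, y⟫ 0 - max ⟪e, z⟫ 0))
    rw [abs_mul, abs_of_nonneg hα] at e3
    rw [Real.dist_eq] at h2
    have e4 := mul_le_mul_of_nonneg_left h3 hα
    have e5 : (α + L) * dist y z ≤ (α + L + 1) * β :=
      mul_le_mul (by linarith) hyz.le dist_nonneg (by positivity)
    have e6 : (α + L + 1) * β = η := by rw [hβ]; field_simp
    rw [e1]
    linarith
  have h5 : v x = r * rescale v r y := by
    rw [rescale, ← hxy, mul_inv_cancel_left₀ hr0.ne']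
  have h6 : max ⟪e, x⟫ 0 = r * max ⟪e, y⟫ 0 := by
    rw [hxy, inner_smul_right, mul_max_of_nonneg _ _ hr0.le, mul_zero]
  rw [h5, h6, mul_left_comm, ← mul_sub, abs_mul, abs_of_pos hr0]
  calc _ ≤ r * (2 * η) := by gcongr
    _ = ε * ‖x‖ := by rw [hη, hr]; field_simp

end IsExteriorSubsol

section Mollification

open ContinuousLinearMap
open scoped Convolution

variable {E : Type*} [NormedAddCommGroup E] [InnerProductSpace ℝ E] [FiniteDimensional ℝ E]
  [MeasurableSpace E] [BorelSpace E] {μ : Measure E} [μ.IsAddHaarMeasure]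

lemma hasFDerivAt_normed_convolution (φ : ContDiffBump (0 : E)) {ψ : E → ℝ} {C : ℝ≥0}
    (hψ : LipschitzWith C ψ) (x : E) :
    HasFDerivAt (φ.normed μ ⋆[lsmul ℝ ℝ, μ] ψ)
      ((φ.normed μ ⋆[lsmul ℝ ℝ, μ] fderiv ℝ ψ) x) x := by
  have hφ : Continuous (φ.normed μ) := φ.continuous_normed
  have hsub : Measurable fun t : E => x - t := measurable_const.sub measurable_id
  refine (hasFDerivAt_integral_of_dominated_loc_of_lip (s := univ)
    (F := fun x t => lsmul ℝ ℝ (φ.normed μ t) (ψ (x - t)))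
    (bound := fun t => C * φ.normed μ t) univ_mem ?_ ?_ ?_ ?_ ?_ ?_).2
  · refine Eventually.of_forall fun y => Continuous.aestronglyMeasurable ?_
    exact hφ.mul (hψ.continuous.comp (continuous_const.sub continuous_id))
  · refine Continuous.integrable_of_hasCompactSupport
      (hφ.mul (hψ.continuous.comp (continuous_const.sub continuous_id))) ?_
    exact φ.hasCompactSupport_normed.mul_right
  · exact (hφ.stronglyMeasurable.smul
      ((measurable_fderiv ℝ ψ).comp hsub).stronglyMeasurable).aestronglyMeasurable
  · refine ae_of_all _ fun t => LipschitzWith.lipschitzOnWith (LipschitzWith.of_dist_le_mul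
      fun y z => ?_)
    have h1 := hψ.dist_le_mul (y - t) (z - t)
    rw [dist_sub_right] at h1
    simp only [lsmul_apply, smul_eq_mul, Real.coe_nnabs, Real.dist_eq, ← mul_sub, abs_mul,
      abs_of_nonneg (φ.nonneg_normed t), NNReal.abs_eq] at h1 ⊢
    nlinarith [φ.nonneg_normed (μ := μ) t]
  · exact φ.integrable_normed.const_mul _
  · have h1 : ∀ᵐ t ∂μ, DifferentiableAt ℝ ψ (x - t) :=
      (quasiMeasurePreserving_sub_left μ x).ae hψ.ae_differentiableAt
    filter_upwards [h1] with t ht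
    have h2 := ht.hasFDerivAt.comp x ((hasFDerivAt_id x).sub_const t)
    exact h2.const_smul (φ.normed μ t)

lemma abs_normed_convolution_sub_le (φ : ContDiffBump (0 : E)) {ψ : E → ℝ} {C : ℝ≥0}
    (hψ : LipschitzWith C ψ) (x : E) :
    |(φ.normed μ ⋆[lsmul ℝ ℝ, μ] ψ) x - ψ x| ≤ C * φ.rOut := by
  rw [← Real.dist_eq]
  refine φ.dist_normed_convolution_le hψ.continuous.aestronglyMeasurable fun y hy => ?_
  refine (hψ.dist_le_mul y x).trans (mul_le_mul_of_nonneg_left ?_ C.2)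
  exact (mem_ball.1 hy).le

/-- A bound on a distribution of order one extends from smooth to Lipschitz test functions. -/
lemma abs_integral_inner_gradient_le_of_contDiff {D : Set E} (hD : IsOpen D) {X : E → E}
    (hX : StronglyMeasurable X) {S : ℝ} (hS : ∀ x, ‖X x‖ ≤ S) {M : ℝ}
    (h : ∀ φ : E → ℝ, ContDiff ℝ (⊤ : ℕ∞) φ → HasCompactSupport φ → tsupport φ ⊆ D →
      |∫ x, ⟪X x, gradient φ x⟫ ∂μ| ≤ M * ∫ x, |φ x| ∂μ)
    {ψ : E → ℝ} {C : ℝ≥0} (hψ : LipschitzWith C ψ) (hc : HasCompactSupport ψ)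
    (hsub : tsupport ψ ⊆ D) :
    |∫ x, ⟪X x, gradient ψ x⟫ ∂μ| ≤ M * ∫ x, |ψ x| ∂μ := by
  obtain ⟨δ, hδ, hδD⟩ := hc.isCompact.exists_cthickening_subset_open hD hsub
  let φ : ℕ → ContDiffBump (0 : E) := fun j =>
    ⟨δ / (2 * (j + 1)), δ / (j + 1), by positivity, by gcongr; linarith⟩
  set ψj : ℕ → E → ℝ := fun j => (φ j).normed μ ⋆[lsmul ℝ ℝ, μ] ψ with hψj
  have hr : ∀ j, (φ j).rOut ≤ δ := fun j => div_le_self hδ.le (by linarith [j.cast_nonneg (α := ℝ)])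
  have hr0 : Tendsto (fun j => (φ j).rOut) atTop (𝓝 0) :=
    (tendsto_one_div_add_atTop_nhds_zero_nat.const_mul δ).congr' (by simp [φ, div_eq_mul_inv])
      |>.trans (by simp)
  have hd := fun j x => hasFDerivAt_normed_convolution (μ := μ) (φ j) hψ x
  have hlip : ∀ j x, ‖fderiv ℝ (ψj j) x‖ ≤ C := by
    intro j x
    rw [(hd j x).fderiv, convolution_def]
    refine (norm_integral_le_of_norm_le ((φ j).integrable_normed.const_mul (C : ℝ))
      (ae_of_all _ fun t => ?_)).trans_eq ?_
    · rw [lsmul_apply, norm_smul, Real.norm_of_nonneg ((φ j).nonneg_normed t), mul_comm]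
      exact mul_le_mul_of_nonneg_right (norm_fderiv_le_of_lipschitz ℝ hψ)
        ((φ j).nonneg_normed t)
    · rw [integral_const_mul, (φ j).integral_normed, mul_one]
  have hsm : ∀ j, ContDiff ℝ (⊤ : ℕ∞) (ψj j) := fun j =>
    (φ j).hasCompactSupport_normed.contDiff_convolution_left _ (φ j).contDiff_normed
      hψ.continuous.locallyIntegrable
  have hts : ∀ j, tsupport (ψj j) ⊆ cthickening δ (tsupport ψ) := by
    intro j
    refine closure_minimal ?_ isClosed_cthickening
    refine (support_convolution_subset_swap _).trans ?_
    rw [(φ j).support_normed_eq]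
    rintro _ ⟨y, hy, z, hz, rfl⟩
    refine mem_cthickening_of_dist_le _ y δ _ (subset_tsupport _ hy) ?_
    rw [dist_eq_norm, add_sub_cancel_left]
    exact (mem_ball_zero_iff.1 hz).le.trans (hr j)
  have hK : IsCompact (cthickening δ (tsupport ψ)) := hc.isCompact.cthickening
  have hcs : ∀ j, HasCompactSupport (ψj j) := fun j =>
    hK.of_isClosed_subset (isClosed_tsupport _) (hts j)
  have hKi : ∀ c : ℝ, Integrable ((cthickening δ (tsupport ψ)).indicator fun _ => c) μ := fun c =>
    (integrable_indicator_iff hK.measurableSet).2 (integrableOn_const hK.measure_lt_top.ne)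
  obtain ⟨N, hN⟩ := hc.exists_bound_of_continuous hψ.continuous
  have hlim : ∀ᵐ x ∂μ, Tendsto (fun j => fderiv ℝ (ψj j) x) atTop (𝓝 (fderiv ℝ ψ x)) := by
    have hloc : LocallyIntegrable (fderiv ℝ ψ) μ :=
      (locallyIntegrable_const (C : ℝ)).mono (measurable_fderiv ℝ ψ).aestronglyMeasurable
        (ae_of_all _ fun x => by
          simpa using norm_fderiv_le_of_lipschitz ℝ hψ)
    filter_upwards [ContDiffBump.ae_convolution_tendsto_right_of_locallyIntegrable (φ := φ)
      (K := 2) hr0 (Eventually.of_forall fun j => le_of_eq (by simp only [φ]; field_simp)) hloc]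
      with x hx
    exact hx.congr fun j => (hd j x).fderiv.symm
  have l1 : Tendsto (fun j => ∫ x, ⟪X x, gradient (ψj j) x⟫ ∂μ) atTop
      (𝓝 (∫ x, ⟪X x, gradient ψ x⟫ ∂μ)) := by
    refine tendsto_integral_of_dominated_convergence
      ((cthickening δ (tsupport ψ)).indicator fun _ => S * C)
      (fun j => (hX.inner (stronglyMeasurable_gradient _)).aestronglyMeasurable) (hKi _)
      (fun j => ae_of_all _ fun x => ?_) ?_
    · by_cases hx : x ∈ cthickening δ (tsupport ψ)
      · rw [indicator_of_mem hx]
        refine (norm_inner_le_norm _ _).trans (mul_le_mul (hS x) ?_ (norm_nonneg _)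
          ((norm_nonneg _).trans (hS x)))
        rw [gradient, LinearIsometryEquiv.norm_map]
        exact hlip j x
      · have : fderiv ℝ (ψj j) x = 0 := by
          by_contra h0
          exact hx (hts j (support_fderiv_subset ℝ h0))
        simp [indicator_of_notMem hx, gradient, this]
    · filter_upwards [hlim] with x hx
      exact tendsto_const_nhds.inner
        (((InnerProductSpace.toDual ℝ E).symm.continuous.tendsto _).comp hx)
  have l2 : Tendsto (fun j => ∫ x, |ψj j x| ∂μ) atTop (𝓝 (∫ x, |ψ x| ∂μ)) := by
    refine tendsto_integral_of_dominated_convergence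
      ((cthickening δ (tsupport ψ)).indicator fun _ => N + C * δ)
      (fun j => (hsm j).continuous.abs.aestronglyMeasurable) (hKi _)
      (fun j => ae_of_all _ fun x => ?_) (ae_of_all _ fun x => ?_)
    · by_cases hx : x ∈ cthickening δ (tsupport ψ)
      · rw [indicator_of_mem hx, norm_abs_eq_norm, Real.norm_eq_abs]
        have h1 := abs_normed_convolution_sub_le (μ := μ) (φ j) hψ x
        have h2 := hN x
        have h3 := abs_sub_abs_le_abs_sub (ψj j x) (ψ x)
        have h4 : (C : ℝ) * (φ j).rOut ≤ C * δ := mul_le_mul_of_nonneg_left (hr j) C.2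
        rw [Real.norm_eq_abs] at h2
        linarith
      · have : ψj j x = 0 := image_eq_zero_of_notMem_tsupport fun h0 => hx (hts j h0)
        simp [indicator_of_notMem hx, this]
    · refine ((tendsto_iff_dist_tendsto_zero).2 (squeeze_zero (fun _ => dist_nonneg)
        (fun j => abs_normed_convolution_sub_le (μ := μ) (φ j) hψ x) ?_)).abs
      simpa using hr0.const_mul (C : ℝ)
  exact le_of_tendsto_of_tendsto' l1.abs (l2.const_mul M) fun j =>
    h _ (hsm j) (hcs j) ((hts j).trans hδD)

end Mollification

section Subsolution

lemma exists_lipschitzWith_smoothTransition : ∃ C : ℝ≥0, LipschitzWith C Real.smoothTransition := by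
  have hd : ContDiff ℝ 1 Real.smoothTransition := Real.smoothTransition.contDiff
  have hc : HasCompactSupport (deriv Real.smoothTransition) := by
    refine HasCompactSupport.of_support_subset_isCompact (isCompact_Icc (a := (0 : ℝ)) (b := 1)) ?_
    intro s hs
    by_contra h
    refine hs ?_
    rw [mem_Icc, not_and_or, not_le, not_le] at h
    rcases h with h | h
    · have : Real.smoothTransition =ᶠ[𝓝 s] fun _ => 0 := by
        filter_upwards [Iio_mem_nhds h] with t ht
        exact Real.smoothTransition.zero_of_nonpos (le_of_lt ht)
      simp [this.deriv_eq]
    · have : Real.smoothTransition =ᶠ[𝓝 s] fun _ => 1 := by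
        filter_upwards [Ioi_mem_nhds h] with t ht
        exact Real.smoothTransition.one_of_one_le (le_of_lt ht)
      simp [this.deriv_eq]
  obtain ⟨N, hN⟩ := hc.exists_bound_of_continuous (hd.continuous_deriv le_rfl)
  refine ⟨N.toNNReal, lipschitzWith_of_nnnorm_deriv_le (hd.differentiable one_ne_zero) fun x => ?_⟩
  exact NNReal.coe_le_coe.1 ((hN x).trans (Real.le_coe_toNNReal N))

lemma LipschitzWith.mul_of_bounded {E : Type*} [PseudoMetricSpace E] {g Ψ : E → ℝ} {C D N : ℝ≥0}
    (hΨ : LipschitzWith C Ψ) (hN : ∀ x, |Ψ x| ≤ N) (hg : LipschitzWith D g) (hg1 : ∀ x, |g x| ≤ 1) :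
    LipschitzWith (N * D + C) fun x => Ψ x * g x := by
  refine LipschitzWith.of_dist_le_mul fun x y => ?_
  have h1 := hΨ.dist_le_mul x y
  have h2 := hg.dist_le_mul x y
  rw [Real.dist_eq] at h1 h2 ⊢
  rw [show Ψ x * g x - Ψ y * g y = Ψ x * (g x - g y) + (Ψ x - Ψ y) * g y by ring]
  refine (abs_add_le _ _).trans ?_
  rw [abs_mul, abs_mul]
  have h3 := mul_le_mul (hN x) h2 (abs_nonneg _) N.2
  have h4 := mul_le_mul h1 (hg1 y) (abs_nonneg _) (by positivity)
  push_cast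
  linarith

variable {E : Type*} [NormedAddCommGroup E] [InnerProductSpace ℝ E] [FiniteDimensional ℝ E]
  [MeasurableSpace E] [BorelSpace E] {μ : Measure E}

lemma integrable_inner_gradient_of_bounded [IsFiniteMeasureOnCompacts μ] {X : E → E}
    (hX : StronglyMeasurable X) {S : ℝ} (hS : ∀ x, ‖X x‖ ≤ S) {Ψ : E → ℝ} {C : ℝ≥0}
    (hΨ : LipschitzWith C Ψ) (hc : HasCompactSupport Ψ) :
    Integrable (fun x => ⟪X x, gradient Ψ x⟫) μ := by
  have hi : Integrable ((tsupport Ψ).indicator fun _ => S * C) μ :=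
    (integrable_indicator_iff hc.isCompact.measurableSet).2
      (integrableOn_const hc.isCompact.measure_lt_top.ne)
  refine hi.mono' (hX.inner (stronglyMeasurable_gradient _)).aestronglyMeasurable
    (ae_of_all _ fun x => ?_)
  by_cases hx : x ∈ tsupport Ψ
  · rw [indicator_of_mem hx]
    exact (norm_inner_le_norm _ _).trans (mul_le_mul (hS x)
      (norm_gradient_le_of_lipschitzWith hΨ x) (norm_nonneg _) ((norm_nonneg _).trans (hS x)))
  · have : fderiv ℝ Ψ x = 0 := by
      by_contra h0
      exact hx (support_fderiv_subset ℝ h0)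
    simp [indicator_of_notMem hx, gradient, this]

variable [μ.IsAddHaarMeasure]

/-- A nonnegative Lipschitz function whose divergence is bounded by `M` on an open set `D`
containing its positivity set in the unit ball is a subsolution across the zero set. -/
lemma integral_inner_gradient_le_of_pos {v : E → ℝ} {L : ℝ≥0} (hv : LipschitzWith L v)
    (hv0 : ∀ x, 0 ≤ v x) {a : E → E →L[ℝ] E} (ha : StronglyMeasurable a) {S : ℝ}
    (hS : ∀ x, ‖a x‖ ≤ S) (hell : ∀ x ξ, 0 ≤ ⟪a x ξ, ξ⟫) {M : ℝ} (hM : 0 ≤ M) {D : Set E}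
    (hD : IsOpen D) (hvD : ∀ x ∈ ball (0 : E) 1, v x ≠ 0 → x ∈ D)
    (h : ∀ φ : E → ℝ, ContDiff ℝ (⊤ : ℕ∞) φ → HasCompactSupport φ → tsupport φ ⊆ D →
      |∫ x, ⟪a x (gradient v x), gradient φ x⟫ ∂μ| ≤ M * ∫ x, |φ x| ∂μ)
    {Ψ : E → ℝ} {C : ℝ≥0} (hΨ : LipschitzWith C Ψ) (hΨ0 : ∀ x, 0 ≤ Ψ x)
    (hsub : tsupport Ψ ⊆ ball 0 1) :
    ∫ x, ⟪a x (gradient v x), gradient Ψ x⟫ ∂μ ≤ M * ∫ x, Ψ x ∂μ := by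
  set X : E → E := fun x => a x (gradient v x) with hXdef
  have hXm : StronglyMeasurable X :=
    isBoundedBilinearMap_apply.continuous.comp_stronglyMeasurable
      (ha.prodMk (stronglyMeasurable_gradient v))
  have hS0 : 0 ≤ S := (norm_nonneg _).trans (hS 0)
  have hXS : ∀ x, ‖X x‖ ≤ S * L := fun x => (ContinuousLinearMap.le_opNorm _ _).trans
    (mul_le_mul (hS x) (norm_gradient_le_of_lipschitzWith hv x) (norm_nonneg _) hS0)
  have hc : HasCompactSupport Ψ := (isCompact_closedBall (0 : E) 1).of_isClosed_subset
    (isClosed_tsupport _) (hsub.trans ball_subset_closedBall)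
  obtain ⟨N, hN⟩ := hc.exists_bound_of_continuous hΨ.continuous
  have hΨi : Integrable Ψ μ := hΨ.continuous.integrable_of_hasCompactSupport hc
  have hXΨ : Integrable (fun x => ⟪X x, gradient Ψ x⟫) μ :=
    integrable_inner_gradient_of_bounded hXm hXS hΨ hc
  obtain ⟨T, hT⟩ := exists_lipschitzWith_smoothTransition
  set g : ℕ → E → ℝ := fun k x => Real.smoothTransition ((k + 1) * v x - 1) with hg
  have hg0 : ∀ k x, 0 ≤ g k x := fun k x => Real.smoothTransition.nonneg _
  have hg1 : ∀ k x, g k x ≤ 1 := fun k x => Real.smoothTransition.le_one _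
  have hgabs : ∀ k x, |g k x| ≤ 1 := fun k x => by rw [abs_of_nonneg (hg0 k x)]; exact hg1 k x
  have hgl : ∀ k : ℕ, LipschitzWith (T * ((k + 1) * L)) (g k) := by
    intro k
    refine hT.comp (LipschitzWith.of_dist_le_mul fun x y => ?_)
    have h1 := hv.dist_le_mul x y
    rw [dist_sub_right, Real.dist_eq, ← mul_sub, abs_mul, ← Real.dist_eq,
      abs_of_nonneg (by positivity)]
    push_cast
    rw [mul_assoc]
    exact mul_le_mul_of_nonneg_left h1 (by positivity)
  have hψl : ∀ k : ℕ, LipschitzWith (N.toNNReal * (T * ((k + 1) * L)) + C) fun x => Ψ x * g k x :=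
    fun k => hΨ.mul_of_bounded (fun x => (hN x).trans (Real.le_coe_toNNReal N)) (hgl k) (hgabs k)
  have hψs : ∀ k, tsupport (fun x => Ψ x * g k x) ⊆ D := by
    intro k
    have h1 : tsupport (fun x => Ψ x * g k x) ⊆ tsupport Ψ ∩ {x | 1 ≤ (k + 1) * v x} := by
      refine closure_minimal (fun x hx => ⟨subset_tsupport _ fun h0 => hx (by simp [h0]), ?_⟩)
        ((isClosed_tsupport _).inter
          (isClosed_le continuous_const (continuous_const.mul hv.continuous)))
      by_contra h0
      refine hx ?_
      rw [mem_ofPred_eq, not_le] at h0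
      have : g k x = 0 := Real.smoothTransition.zero_of_nonpos (by linarith)
      simp [this]
    refine h1.trans fun x hx => hvD x (hsub hx.1) fun h0 => ?_
    have := hx.2
    rw [mem_ofPred_eq, h0] at this
    norm_num at this
  have hgrad : ∀ k, ∀ᵐ x ∂μ, g k x * ⟪X x, gradient Ψ x⟫ ≤
      ⟪X x, gradient (fun x => Ψ x * g k x) x⟫ := by
    intro k
    filter_upwards [hv.ae_differentiableAt (μ := μ), hΨ.ae_differentiableAt (μ := μ)] with x hx hx'
    have hst : HasDerivAt Real.smoothTransition (deriv Real.smoothTransition ((k + 1) * v x - 1))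
        ((k + 1) * v x - 1) :=
      ((Real.smoothTransition.contDiff (n := 1)).differentiable one_ne_zero _).hasDerivAt
    have h1 := hst.comp_hasFDerivAt (h₂ := Real.smoothTransition) x
      ((hx.hasFDerivAt.const_mul ((k : ℝ) + 1)).sub_const 1)
    have h2 := (hx'.hasFDerivAt.mul h1).fderiv
    have h3 : 0 ≤ deriv Real.smoothTransition ((k + 1) * v x - 1) :=
      Real.smoothTransition.monotone.deriv_nonneg
    have h4 : 0 ≤ fderiv ℝ v x (X x) := by
      rw [← inner_gradient_left, real_inner_comm]
      exact hell x _
    rw [real_inner_comm, inner_gradient_left, real_inner_comm, inner_gradient_left]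
    have h5 : fderiv ℝ (fun x => Ψ x * g k x) x = _ := h2
    rw [h5]
    simp only [_root_.add_apply, _root_.smul_apply, smul_eq_mul]
    exact le_add_of_nonneg_left
      (mul_nonneg (hΨ0 x) (mul_nonneg h3 (mul_nonneg (by positivity) h4)))
  have hle : ∀ k, ∫ x, g k x * ⟪X x, gradient Ψ x⟫ ∂μ ≤ M * ∫ x, Ψ x ∂μ := by
    intro k
    have hck : HasCompactSupport fun x => Ψ x * g k x := hc.mul_right
    have h1 := abs_integral_inner_gradient_le_of_contDiff hD hXm hXS h (hψl k) hck (hψs k)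
    have hi : Integrable (fun x => ⟪X x, gradient (fun x => Ψ x * g k x) x⟫) μ :=
      integrable_inner_gradient_of_bounded hXm hXS (hψl k) hck
    refine (integral_mono_ae ?_ hi (hgrad k)).trans ((le_abs_self _).trans (h1.trans ?_))
    · exact hXΨ.bdd_mul (c := 1) (hgl k).continuous.aestronglyMeasurable (ae_of_all _ (hgabs k))
    · refine mul_le_mul_of_nonneg_left (integral_mono ?_ hΨi fun x => ?_) hM
      · exact ((hψl k).continuous.integrable_of_hasCompactSupport hck).abs
      · simp only
        rw [abs_of_nonneg (mul_nonneg (hΨ0 x) (hg0 k x))]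
        exact mul_le_of_le_one_right (hΨ0 x) (hg1 k x)
  refine le_of_tendsto' (tendsto_integral_of_dominated_convergence
    (fun x => ‖⟪X x, gradient Ψ x⟫‖) (fun k => ?_) hXΨ.norm
    (fun k => ae_of_all _ fun x => ?_) (ae_of_all _ fun x => ?_)) hle
  · exact (hgl k).continuous.aestronglyMeasurable.mul hXΨ.1
  · rw [norm_mul]
    exact mul_le_of_le_one_left (norm_nonneg _) (hgabs k x)
  · rcases (hv0 x).eq_or_lt with h0 | h0
    · have h1 : a x (gradient v x) = 0 := by
        rw [gradient_eq_zero_of_isLocalMin, map_zero]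
        exact Eventually.of_forall fun y => h0 ▸ hv0 y
      simp only [hXdef, h1, inner_zero_left, mul_zero]
      exact tendsto_const_nhds
    · refine tendsto_const_nhds.congr' ?_
      obtain ⟨k₀, hk₀⟩ := exists_nat_gt (2 / v x)
      filter_upwards [eventually_ge_atTop k₀] with k hk
      have h1 : (2 : ℝ) < k₀ * v x := (div_lt_iff₀ h0).1 hk₀
      have h2 : (k₀ : ℝ) ≤ k := Nat.cast_le.2 hk
      have : g k x = 1 := Real.smoothTransition.one_of_one_le (by nlinarith)
      rw [this, one_mul]

end Subsolution

section Reduction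

lemma FrozenCoeff.exists_of_elliptic {E : Type*} [NormedAddCommGroup E] [InnerProductSpace ℝ E]
    [FiniteDimensional ℝ E] {A : E →L[ℝ] E} (hA : ∀ x y, ⟪A x, y⟫ = ⟪x, A y⟫) {lam : ℝ}
    (hlam : 0 < lam) (hell : ∀ ξ, lam * ‖ξ‖ ^ 2 ≤ ⟪A ξ, ξ⟫) : ∃ P : FrozenCoeff E, P.A = A := by
  have hinj : Function.Injective A := by
    refine (injective_iff_map_eq_zero A).2 fun x hx => ?_
    have h1 := hell x
    rw [hx, inner_zero_left] at h1
    by_contra h0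
    have := norm_pos_iff.2 h0
    nlinarith [mul_pos hlam (pow_pos this 2)]
  let T := (LinearEquiv.ofInjectiveEndo (A : E →ₗ[ℝ] E) hinj).toContinuousLinearEquiv
  have hT : ∀ y, T y = A y := fun y => rfl
  have hAB : ∀ y, A (T.symm y) = y := fun y => by rw [← hT, T.apply_symm_apply]
  refine ⟨⟨A, T.symm, hAB, fun y => ?_, hA, fun x y => ?_, lam / (‖A‖ + 1) ^ 2, by positivity,
    fun y => ?_⟩, rfl⟩
  · exact T.symm_apply_apply y
  · have := hA (T.symm x) (T.symm y)
    rw [hAB, hAB] at this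
    exact this.symm
  · have h1 := hell (T.symm y)
    have h2 : ‖y‖ ≤ (‖A‖ + 1) * ‖T.symm y‖ := by
      conv_lhs => rw [← hAB y]
      exact (A.le_opNorm _).trans (by gcongr; linarith)
    rw [hAB, real_inner_comm] at h1
    refine le_trans ?_ h1
    rw [div_mul_eq_mul_div, div_le_iff₀ (by positivity), mul_assoc]
    refine mul_le_mul_of_nonneg_left ?_ hlam.le
    rw [← mul_pow, mul_comm]
    exact pow_le_pow_left₀ (norm_nonneg _) h2 2

lemma LipschitzOnWith.indicator_closure {E : Type*} [NormedAddCommGroup E] [NormedSpace ℝ E]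
    {Ω s : Set E} (hs : Convex ℝ s) {u : E → ℝ} {L : ℝ≥0}
    (hu : LipschitzOnWith L u (closure Ω ∩ s)) (h0 : ∀ x ∈ frontier Ω ∩ s, u x = 0) :
    LipschitzOnWith L ((closure Ω).indicator u) s := by
  have key : ∀ x ∈ closure Ω ∩ s, ∀ y ∈ s, y ∉ closure Ω → |u x| ≤ L * dist x y := by
    intro x hx y hy hyΩ
    obtain ⟨z, hz, hzf⟩ : ∃ z ∈ segment ℝ x y, z ∈ frontier Ω := by
      by_contra! hno
      have hmem : ∀ z ∈ segment ℝ x y, z ∈ closure Ω → z ∈ interior (closure Ω) := by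
        intro z hz hzΩ
        by_contra hzi
        exact hno z hz (frontier_closure_subset ⟨subset_closure hzΩ, hzi⟩)
      obtain ⟨z, -, hz, hz'⟩ := (convex_segment (𝕜 := ℝ) x y).isPreconnected
        (interior (closure Ω)) (closure Ω)ᶜ isOpen_interior isClosed_closure.isOpen_compl
        (fun z hz => or_iff_not_imp_right.2 fun h => hmem z hz (not_not.1 h))
        ⟨x, left_mem_segment ℝ x y, hmem x (left_mem_segment ℝ x y) hx.1⟩
        ⟨y, right_mem_segment ℝ x y, hyΩ⟩
      exact hz' (interior_subset hz)
    have hzs : z ∈ s := hs.segment_subset hx.2 hy hz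
    have h1 := hu.dist_le_mul x hx z ⟨frontier_subset_closure hzf, hzs⟩
    rw [h0 z ⟨hzf, hzs⟩, Real.dist_eq, sub_zero] at h1
    refine h1.trans (mul_le_mul_of_nonneg_left ?_ L.2)
    linarith [dist_add_dist_of_mem_segment hz, dist_nonneg (x := z) (y := y)]
  refine LipschitzOnWith.of_dist_le_mul fun x hx y hy => ?_
  by_cases hxΩ : x ∈ closure Ω <;> by_cases hyΩ : y ∈ closure Ω
  · rw [indicator_of_mem hxΩ, indicator_of_mem hyΩ]
    exact hu.dist_le_mul x ⟨hxΩ, hx⟩ y ⟨hyΩ, hy⟩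
  · rw [indicator_of_mem hxΩ, indicator_of_notMem hyΩ, Real.dist_eq, sub_zero]
    exact key x ⟨hxΩ, hx⟩ y hy hyΩ
  · rw [indicator_of_notMem hxΩ, indicator_of_mem hyΩ, Real.dist_eq, zero_sub, abs_neg,
      dist_comm]
    exact key y ⟨hyΩ, hy⟩ x hx hxΩ
  · rw [indicator_of_notMem hxΩ, indicator_of_notMem hyΩ, dist_self]
    positivity

lemma HolderSemi.continuousOn {A : EucSp n → (EucSp n →L[ℝ] EucSp n)} {γ K : ℝ}
    {s : Set (EucSp n)} (hA : HolderSemi A γ K s) (hγ : 0 < γ) : ContinuousOn A s := by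
  intro x hx
  refine tendsto_iff_norm_sub_tendsto_zero.2 (squeeze_zero' (g := fun y => K * ‖y - x‖ ^ γ)
    (Eventually.of_forall fun _ => norm_nonneg _)
    (eventually_nhdsWithin_of_forall fun y hy => hA y hy x hx) ?_)
  have h1 : ContinuousAt (fun y => K * ‖y - x‖ ^ γ) x :=
    ((by fun_prop : ContinuousAt (fun y => ‖y - x‖) x).rpow_const (Or.inr hγ.le)).const_mul K
  have h2 := h1.tendsto
  simp only [sub_self, norm_zero, Real.zero_rpow hγ.ne', mul_zero] at h2
  exact h2.mono_left nhdsWithin_le_nhds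

/-- If `𝓛 u = f` weakly in `D` with `|f| ≤ M`, then `div (A ∇u)` is bounded by `M` in `D`. -/
lemma WeakEq.abs_setIntegral_le {A : EucSp n → (EucSp n →L[ℝ] EucSp n)} {u f : EucSp n → ℝ}
    {D : Set (EucSp n)} (h : WeakEq A u f D) (hD : MeasurableSet D) {M : ℝ} (hM : 0 ≤ M)
    (hf : ∀ x ∈ D, |f x| ≤ M) {φ : EucSp n → ℝ} (hφ : IsTest D φ) :
    |∫ x in D, ⟪A x (gradient u x), gradient φ x⟫| ≤ M * ∫ x, |φ x| := by
  have hi : Integrable (fun x => M * |φ x|) :=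
    ((hφ.1.continuous.integrable_of_hasCompactSupport hφ.2.1).abs).const_mul M
  rw [h φ hφ, abs_neg, ← integral_const_mul]
  calc |∫ x in D, f x * φ x| ≤ ∫ x in D, M * |φ x| := by
        rw [← Real.norm_eq_abs]
        refine norm_integral_le_of_norm_le hi.integrableOn
          (ae_restrict_of_forall_mem hD fun x hx => ?_)
        rw [norm_mul]
        exact mul_le_mul_of_nonneg_right (hf x hx) (abs_nonneg _)
    _ ≤ ∫ x, M * |φ x| := setIntegral_le_integral hi (ae_of_all _ fun x => by positivity)

end Reduction

section Main

lemma norm_sq_add_lt_zero_iff {E : Type*} [NormedAddCommGroup E] [InnerProductSpace ℝ E] {e : E}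
    (he : ‖e‖ = 1) {ρ : ℝ} (hρ : 0 < ρ) (x : E) :
    ‖x‖ ^ 2 + 2 * ρ * ⟪e, x⟫ < 0 ↔ x ∈ ball (-(ρ • e)) ρ := by
  have h1 : ‖x + ρ • e‖ ^ 2 = ‖x‖ ^ 2 + 2 * ρ * ⟪e, x⟫ + ρ ^ 2 := by
    rw [norm_add_sq_real, inner_smul_right, real_inner_comm, norm_smul, he, Real.norm_of_nonneg hρ.le]
    ring
  rw [mem_ball, dist_eq_norm, sub_neg_eq_add, ← sq_lt_sq₀ (norm_nonneg _) hρ.le, h1]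
  constructor <;> intro h <;> linarith

/-- Extending a solution by zero across the boundary of `Ω` gives a subsolution in the unit
ball. -/
lemma exists_isExteriorSubsol {A : EucSp n → (EucSp n →L[ℝ] EucSp n)} {γ lam Lam K : ℝ}
    (hγ : γ ∈ Set.Ioo (0 : ℝ) 1) (hlam : 0 < lam) (hK : 0 < K)
    (hell : IsElliptic A lam Lam (ball 0 1)) (hsym : IsSymmCoeff A (ball 0 1))
    (hhold : HolderSemi A γ K (ball 0 1)) {Ω : Set (EucSp n)} (hΩ : IsOpen Ω)
    (h0 : (0 : EucSp n) ∈ frontier Ω) {e : EucSp n} (he : ‖e‖ = 1) {ρ : ℝ} (hρ : 0 < ρ)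
    (hext : ball (-(ρ • e)) ρ ⊆ (closure Ω)ᶜ) {f : EucSp n → ℝ} {M : ℝ}
    (hf : ∀ x ∈ Ω ∩ ball 0 1, |f x| ≤ M) {u : EucSp n → ℝ} {L : ℝ≥0}
    (hLip : LipschitzOnWith L u (closure Ω ∩ ball 0 1))
    (hpos : ∀ x ∈ closure Ω ∩ ball (0 : EucSp n) 1, 0 ≤ u x)
    (heq : WeakEq A u f (Ω ∩ ball 0 1))
    (hzero : ∀ x ∈ frontier Ω ∩ ball (0 : EucSp n) 1, u x = 0) :
    ∃ (P : FrozenCoeff (EucSp n)) (a : EucSp n → (EucSp n →L[ℝ] EucSp n)) (v : EucSp n → ℝ),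
      IsExteriorSubsol volume P e a L ρ K γ M v ∧ EqOn v u (closure Ω ∩ ball 0 1) := by
  have hb0 : (0 : EucSp n) ∈ ball (0 : EucSp n) 1 := mem_ball_self one_pos
  obtain ⟨P, hP⟩ := FrozenCoeff.exists_of_elliptic (hsym 0 hb0) hlam fun ξ => (hell 0 hb0 ξ).1
  have hM : 0 ≤ M := by
    obtain ⟨y, hy, hyΩ⟩ := mem_closure_iff.1 (frontier_subset_closure h0) _ isOpen_ball hb0
    exact (abs_nonneg _).trans (hf y ⟨hyΩ, hy⟩)
  classical
  set a : EucSp n → (EucSp n →L[ℝ] EucSp n) := (ball 0 1).piecewise A fun _ => A 0 with ha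
  have ha1 : ∀ x ∈ ball (0 : EucSp n) 1, a x = A x := fun x hx => piecewise_eq_of_mem _ _ _ hx
  have ha2 : ∀ x ∉ ball (0 : EucSp n) 1, a x = A 0 := fun x hx => piecewise_eq_of_notMem _ _ _ hx
  have hholder : ∀ x, ‖a x - A 0‖ ≤ K * ‖x‖ ^ γ := by
    intro x
    by_cases hx : x ∈ ball (0 : EucSp n) 1
    · simpa [ha1 x hx] using hhold x hx 0 hb0
    · rw [ha2 x hx, sub_self, norm_zero]
      positivity
  have hbound : ∀ x, ‖a x‖ ≤ ‖A 0‖ + K := by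
    intro x
    by_cases hx : x ∈ ball (0 : EucSp n) 1
    · have h1 : ‖x‖ ^ γ ≤ 1 :=
        Real.rpow_le_one (norm_nonneg _) (mem_ball_zero_iff.1 hx).le hγ.1.le
      have h2 := norm_add_le (A 0) (a x - A 0)
      rw [add_sub_cancel] at h2
      nlinarith [hholder x]
    · rw [ha2 x hx]
      linarith
  have hapos : ∀ x ξ, 0 ≤ ⟪a x ξ, ξ⟫ := by
    intro x ξ
    by_cases hx : x ∈ ball (0 : EucSp n) 1
    · rw [ha1 x hx]
      exact le_trans (by positivity) (hell x hx ξ).1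
    · rw [ha2 x hx]
      exact le_trans (by positivity) (hell 0 hb0 ξ).1
  have ham : StronglyMeasurable a :=
    ((hhold.continuousOn hγ.1).measurable_piecewise continuousOn_const
      measurableSet_ball).stronglyMeasurable
  obtain ⟨g, hg, hgu⟩ := (hLip.indicator_closure (convex_ball 0 1) hzero).extend_real
  set v : EucSp n → ℝ := fun x => max (g x) 0 with hv
  have hv1 : EqOn v u (closure Ω ∩ ball 0 1) := fun x hx => by
    simp only [hv]
    rw [← hgu hx.2, indicator_of_mem hx.1, max_eq_left (hpos x hx)]
  have hv2 : ∀ x ∈ ball (0 : EucSp n) 1, x ∉ Ω → v x = 0 := fun x hx hxΩ => by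
    by_cases hxc : x ∈ closure Ω
    · rw [hv1 ⟨hxc, hx⟩, hzero x ⟨hΩ.frontier_eq ▸ ⟨hxc, hxΩ⟩, hx⟩]
    · simp only [hv]
      rw [← hgu hx, indicator_of_notMem hxc, max_self]
  have hvL : LipschitzWith L v := hg.max_const 0
  have hv0 : ∀ x, 0 ≤ v x := fun x => le_max_right _ _
  have hD : IsOpen (Ω ∩ ball (0 : EucSp n) 1) := hΩ.inter isOpen_ball
  have hdiv : ∀ φ : EucSp n → ℝ, ContDiff ℝ (⊤ : ℕ∞) φ → HasCompactSupport φ →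
      tsupport φ ⊆ Ω ∩ ball 0 1 →
      |∫ x, ⟪a x (gradient v x), gradient φ x⟫| ≤ M * ∫ x, |φ x| := by
    intro φ h1 h2 h3
    rw [← setIntegral_eq_integral_of_forall_compl_eq_zero (s := Ω ∩ ball 0 1)]
    · rw [setIntegral_congr_fun (g := fun x => ⟪A x (gradient u x), gradient φ x⟫)
        hD.measurableSet]
      · exact heq.abs_setIntegral_le hD.measurableSet hM hf ⟨h1, h2, h3⟩
      · intro x hx
        have : v =ᶠ[𝓝 x] u := by
          filter_upwards [hD.mem_nhds hx] with y hy
          exact hv1 ⟨subset_closure hy.1, hy.2⟩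
        simp only [ha1 x hx.2, this.gradient_eq]
    · intro x hx
      have : fderiv ℝ φ x = 0 := by
        by_contra h4
        exact hx (h3 (support_fderiv_subset ℝ h4))
      simp [gradient, this]
  refine ⟨P, a, v, ?_, hv1⟩
  exact
    { norm_e := he
      rho_pos := hρ
      K_nonneg := hK.le
      gamma_pos := hγ.1
      gamma_lt := hγ.2
      M_nonneg := hM
      lipschitz := hvL
      nonneg := hv0
      map_zero := hv2 0 hb0 fun h => (hΩ.frontier_eq ▸ h0).2 h
      eq_zero := fun x hx hlt => hv2 x (mem_ball_zero_iff.2 hx) fun h =>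
        hext ((norm_sq_add_lt_zero_iff he hρ x).1 hlt) (subset_closure h)
      measurable := ham
      holder := hP ▸ hholder
      subsol := fun Ψ C hΨ hΨ0 hs => integral_inner_gradient_le_of_pos hvL hv0 ham hbound hapos hM
        hD (fun x hx hvx => ⟨not_not.1 fun h => hvx (hv2 x hx h), hx⟩) hdiv hΨ hΨ0 hs }

end Main

/-- **Lemma 2.2 (Asymptotic development, exterior touching ball).** -/
theorem asymptotic_dev_exterior_ball
    {n : ℕ} (hn : 2 ≤ n)
    (A : EucSp n → (EucSp n →L[ℝ] EucSp n)) (γ lam Lam K : ℝ)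
    (hγ : γ ∈ Set.Ioo (0:ℝ) 1) (hlam : 0 < lam) (hlamLam : lam ≤ Lam) (hK : 0 < K)
    (hell : IsElliptic A lam Lam (ball 0 1)) (hsym : IsSymmCoeff A (ball 0 1))
    (hhold : HolderSemi A γ K (ball 0 1))
    (Ω : Set (EucSp n)) (hΩ : IsOpen Ω) (h0 : (0 : EucSp n) ∈ frontier Ω)
    (ρ : ℝ) (hρ : 0 < ρ)
    (hext : ball (-(ρ • EuclideanSpace.single (⟨0, by omega⟩ : Fin n) (1:ℝ))) ρ ⊆ (closure Ω)ᶜ)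
    (f : EucSp n → ℝ) (M : ℝ) (hf : ∀ x ∈ Ω ∩ ball 0 1, |f x| ≤ M)
    (u : EucSp n → ℝ) (L : ℝ≥0)
    (hLip : LipschitzOnWith L u (closure Ω ∩ ball 0 1))
    (hpos : ∀ x ∈ closure Ω ∩ ball (0 : EucSp n) 1, 0 ≤ u x)
    (heq : WeakEq A u f (Ω ∩ ball 0 1))
    (hzero : ∀ x ∈ frontier Ω ∩ ball (0 : EucSp n) 1, u x = 0) :
    ∃ α : ℝ, 0 ≤ α ∧
      SmallO (fun x => u x - α * x ⟨0, by omega⟩) 0 (closure Ω ∩ ball 0 1) ∧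
      (0 < α → SmallO (fun x => x (⟨0, by omega⟩ : Fin n)) 0 (frontier Ω ∩ ball 0 1)) := by
  set e : EucSp n := EuclideanSpace.single (⟨0, by omega⟩ : Fin n) (1 : ℝ) with he_def
  have he : ‖e‖ = 1 := by simp [he_def]
  have hcoord : ∀ x : EucSp n, x ⟨0, by omega⟩ = ⟪e, x⟫ := fun x => by
    rw [he_def, EuclideanSpace.inner_single_left]
    simp
  obtain ⟨P, a, v, hsub, hvu⟩ := exists_isExteriorSubsol hγ hlam hK hell hsym hhold hΩ h0 he hρ hext
    hf hLip hpos heq hzero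
  obtain ⟨α, hα, hlim⟩ := hsub.exists_forall_eventually_le
  have hmain : SmallO (fun x => u x - α * x ⟨0, by omega⟩) 0 (closure Ω ∩ ball 0 1) := by
    intro ε hε
    have hδ : 0 < ε * ρ / (α + 1) := by positivity
    filter_upwards [nhdsWithin_le_nhds (hlim (ε / 2) (half_pos hε)),
      nhdsWithin_le_nhds (ball_mem_nhds (0 : EucSp n) hδ), self_mem_nhdsWithin] with x hx hxδ hxs
    have hneg : 0 ≤ ‖x‖ ^ 2 + 2 * ρ * ⟪e, x⟫ := not_lt.1 fun h =>
      hext ((norm_sq_add_lt_zero_iff he hρ x).1 h) hxs.1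
    rw [hvu hxs] at hx
    rw [sub_zero, hcoord]
    rw [mem_ball_zero_iff, lt_div_iff₀ (by positivity)] at hxδ
    have hdiff : |α * max ⟪e, x⟫ 0 - α * ⟪e, x⟫| ≤ ε / 2 * ‖x‖ := by
      rw [← mul_sub, abs_of_nonneg (mul_nonneg hα (sub_nonneg.2 (le_max_left _ _)))]
      rcases le_total 0 ⟪e, x⟫ with h | h
      · rw [max_eq_left h, sub_self, mul_zero]
        positivity
      · rw [max_eq_right h, zero_sub]
        have h1 : -⟪e, x⟫ ≤ ‖x‖ ^ 2 / (2 * ρ) := by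
          rw [le_div_iff₀ (by positivity)]
          linarith
        refine (mul_le_mul_of_nonneg_left h1 hα).trans ?_
        rw [mul_div_assoc', div_le_iff₀ (by positivity)]
        nlinarith [norm_nonneg x]
    calc |u x - α * ⟪e, x⟫|
        ≤ |u x - α * max ⟪e, x⟫ 0| + |α * max ⟪e, x⟫ 0 - α * ⟪e, x⟫| := abs_sub_le _ _ _
      _ ≤ ε * ‖x‖ := by linarith
  refine ⟨α, hα, hmain, fun hα0 ε hε => ?_⟩
  have hsubset : frontier Ω ∩ ball (0 : EucSp n) 1 ⊆ closure Ω ∩ ball 0 1 :=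
    inter_subset_inter_left _ frontier_subset_closure
  filter_upwards [nhdsWithin_mono _ hsubset (hmain (α * ε) (by positivity)),
    self_mem_nhdsWithin] with x hx hxs
  rw [hzero x hxs, zero_sub, abs_neg, abs_mul, abs_of_pos hα0, mul_assoc] at hx
  exact le_of_mul_le_mul_left hx hα0
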